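/- Let 1 < p < ∞, d, n ∈ ℕ, and let W be a matrix A_p weight on ℝ^d with reducing operators V_I. Then there is a constant C depending only on p, n, d such that for every f⃗ ∈ L^p(W), ( ∫_{ℝ^d} ( ∑_{I ∈ 𝒟} ∑_{ε ∈ 𝒮} |V_I f⃗_I^ε|² |I|^{−1} χ_I(x) )^{p/2} dx )^{1/p} ≤ C ‖W‖_{A_p}^{2/p + ⌈p'⌉/p} ‖f⃗‖_{L^p(W)}, where p' = p/(p−1) and ⌈p'⌉ is the smallest integer ≥ p'. -/

import Mathlib

open MeasureTheory ENNReal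
open scoped ComplexOrder

noncomputable section

/-! ## Basic linear-algebra notation -/

/-- The operator norm of an `n × n` complex matrix, viewed as an operator on the
Euclidean space `ℂⁿ`. -/
def matNorm {n : ℕ} (M : Matrix (Fin n) (Fin n) ℂ) : ℝ :=
  ‖Matrix.toEuclideanCLM (𝕜 := ℂ) (n := Fin n) M‖

/-- A matrix applied to a vector of `ℂⁿ` (with its Euclidean norm). -/
def mApp {n : ℕ} (M : Matrix (Fin n) (Fin n) ℂ) (v : EuclideanSpace ℂ (Fin n)) :
    EuclideanSpace ℂ (Fin n) :=
  Matrix.toEuclideanCLM (𝕜 := ℂ) (n := Fin n) M v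


/-- Entrywise measurability of a matrix-valued function. -/
def MatMeasurable {d n : ℕ} (W : (Fin d → ℝ) → Matrix (Fin n) (Fin n) ℂ) : Prop :=
  ∀ i j, Measurable fun x => W x i j

/-! ## Dyadic cubes and Haar functions -/

/-- A dyadic cube in `ℝ^d`, with side length `2^k` and lower-left corner `(m i * 2^k)_i`. -/
structure DCube (d : ℕ) where
  k : ℤ
  m : Fin d → ℤ

namespace DCube

variable {d : ℕ}

/-- The (half-open) cube in `ℝ^d` determined by a dyadic cube. -/
def set (I : DCube d) : Set (Fin d → ℝ) :=
  {x | ∀ i, (I.m i : ℝ) * 2 ^ I.k ≤ x i ∧ x i < ((I.m i : ℝ) + 1) * 2 ^ I.k}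

/-- The volume `|I| = (2^k)^d` of a dyadic cube. -/
def vol (I : DCube d) : ℝ := ((2 : ℝ) ^ I.k) ^ d

/-- The lower-left corner of a dyadic cube. -/
def corner (I : DCube d) : Fin d → ℝ := fun i => (I.m i : ℝ) * 2 ^ I.k

/-- The side length of a dyadic cube. -/
def side (I : DCube d) : ℝ := (2 : ℝ) ^ I.k

end DCube

/-- One-dimensional Haar functions on the dyadic interval `[m·2^k, (m+1)·2^k)`:
`haar1D true` is the non-cancellative `|I|^{-1/2} χ_I`, while `haar1D false` is
`|I|^{-1/2} (χ_{I_ℓ} - χ_{I_r})`. -/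
def haar1D (ε : Bool) (k mm : ℤ) (t : ℝ) : ℝ :=
  if ε then
    Set.indicator {s : ℝ | (mm : ℝ) * 2 ^ k ≤ s ∧ s < ((mm : ℝ) + 1) * 2 ^ k}
      (fun _ => ((2 : ℝ) ^ k) ^ (-(1 / 2 : ℝ))) t
  else
    Set.indicator {s : ℝ | (mm : ℝ) * 2 ^ k ≤ s ∧ s < (mm : ℝ) * 2 ^ k + 2 ^ (k - 1)}
      (fun _ => ((2 : ℝ) ^ k) ^ (-(1 / 2 : ℝ))) t -
    Set.indicator {s : ℝ | (mm : ℝ) * 2 ^ k + 2 ^ (k - 1) ≤ s ∧ s < ((mm : ℝ) + 1) * 2 ^ k}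
      (fun _ => ((2 : ℝ) ^ k) ^ (-(1 / 2 : ℝ))) t

/-- The signature set `𝒮 = {0,1}^d \ {(1,…,1)}` indexing the cancellative Haar functions. -/
def Sfin (d : ℕ) : Finset (Fin d → Bool) := Finset.univ.erase (fun _ => true)

/-- The Haar function `h_I^ε = ∏ i, h_{I_i}^{ε_i}` associated to a dyadic cube `I ⊂ ℝ^d`
and a signature `ε ∈ {0,1}^d`. -/
def haarFn {d : ℕ} (I : DCube d) (ε : Fin d → Bool) (x : Fin d → ℝ) : ℝ :=
  ∏ i, haar1D (ε i) I.k (I.m i) (x i)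

/-- The (vector of) Haar coefficients `f_I^ε = ∫ f h_I^ε` of a `ℂⁿ`-valued function. -/
def haarCoef {d n : ℕ} (f : (Fin d → ℝ) → EuclideanSpace ℂ (Fin n)) (I : DCube d)
    (ε : Fin d → Bool) : EuclideanSpace ℂ (Fin n) :=
  ∫ x, haarFn I ε x • f x

/-! ## Matrix `A_p` weights and reducing operators -/

/-- The (closed, axis-parallel) cube with corner `c` and side length `r`. -/
def cubeSet {d : ℕ} (c : Fin d → ℝ) (r : ℝ) : Set (Fin d → ℝ) :=
  {x | ∀ i, c i ≤ x i ∧ x i ≤ c i + r}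

/-- The matrix `A_p` characteristic `‖W‖_{A_p}` of a matrix weight `W`, expressed in terms of
`W1p = W^{1/p}` (so that `W^{-1/p} = (W1p)⁻¹`):
`sup_I (1/|I|) ∫_I ((1/|I|) ∫_I ‖W^{1/p}(x) W^{-1/p}(t)‖^{p'} dt)^{p/p'} dx`,
the supremum being over all cubes `I ⊂ ℝ^d`.  Here `p' = p/(p-1)` and `p/p' = p - 1`. -/
def apNorm {d n : ℕ} (p : ℝ) (W1p : (Fin d → ℝ) → Matrix (Fin n) (Fin n) ℂ) : ℝ≥0∞ :=
  ⨆ (c : Fin d → ℝ) (r : ℝ) (_ : 0 < r),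
    (ENNReal.ofReal (r ^ d))⁻¹ *
      ∫⁻ x in cubeSet c r,
        ((ENNReal.ofReal (r ^ d))⁻¹ *
            ∫⁻ t in cubeSet c r,
              ENNReal.ofReal (matNorm (W1p x * (W1p t)⁻¹)) ^ (p / (p - 1))) ^ (p - 1)

/-- The `L^q` average `(|I|^{-1} ∫_I ‖A(x) e‖^q dx)^{1/q}` over a dyadic cube. -/
def redAvgD {d n : ℕ} (q : ℝ) (A : (Fin d → ℝ) → Matrix (Fin n) (Fin n) ℂ) (I : DCube d)
    (e : EuclideanSpace ℂ (Fin n)) : ℝ≥0∞ :=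
  ((ENNReal.ofReal I.vol)⁻¹ * ∫⁻ x in I.set, ENNReal.ofReal ‖mApp (A x) e‖ ^ q) ^ (1 / q)

/-- `V` is a family of reducing operators for the weight `W = (W1p)^p` (indexed by dyadic
cubes), with comparability constants `c₁, c₂`:  each `V I` is positive definite and
`|V_I e| ≈ (|I|^{-1} ∫_I |W^{1/p}(x) e|^p dx)^{1/p}`. -/
def IsReducing {d n : ℕ} (p c₁ c₂ : ℝ) (W1p : (Fin d → ℝ) → Matrix (Fin n) (Fin n) ℂ)
    (V : DCube d → Matrix (Fin n) (Fin n) ℂ) : Prop :=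
  ∀ I : DCube d, (V I).PosDef ∧ ∀ e : EuclideanSpace ℂ (Fin n),
    ENNReal.ofReal c₁ * redAvgD p W1p I e ≤ ENNReal.ofReal ‖mApp (V I) e‖ ∧
    ENNReal.ofReal ‖mApp (V I) e‖ ≤ ENNReal.ofReal c₂ * redAvgD p W1p I e

/-- `V'` is a family of dual reducing operators for the weight `W = (W1p)^p`:
`|V_I' e| ≈ (|I|^{-1} ∫_I |W^{-1/p}(x) e|^{p'} dx)^{1/p'}` with `p' = p/(p-1)`. -/
def IsDualReducing {d n : ℕ} (p c₁ c₂ : ℝ) (W1p : (Fin d → ℝ) → Matrix (Fin n) (Fin n) ℂ)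
    (V' : DCube d → Matrix (Fin n) (Fin n) ℂ) : Prop :=
  ∀ I : DCube d, (V' I).PosDef ∧ ∀ e : EuclideanSpace ℂ (Fin n),
    ENNReal.ofReal c₁ * redAvgD (p / (p - 1)) (fun x => (W1p x)⁻¹) I e ≤
        ENNReal.ofReal ‖mApp (V' I) e‖ ∧
    ENNReal.ofReal ‖mApp (V' I) e‖ ≤
        ENNReal.ofReal c₂ * redAvgD (p / (p - 1)) (fun x => (W1p x)⁻¹) I e

/-- The `L^p(W)` norm `(∫ |W^{1/p}(x) f(x)|^p dx)^{1/p}` (as a value in `[0,∞]`). -/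
def wNorm {d n : ℕ} (p : ℝ) (W1p : (Fin d → ℝ) → Matrix (Fin n) (Fin n) ℂ)
    (f : (Fin d → ℝ) → EuclideanSpace ℂ (Fin n)) : ℝ≥0∞ :=
  (∫⁻ x, ENNReal.ofReal ‖mApp (W1p x) (f x)‖ ^ p) ^ (1 / p)

/-- The square-function expression
`∑_{I ∈ 𝒟} ∑_{ε ∈ 𝒮} |A_I f_I^ε|² |I|^{-1} χ_I(x)` for a family of matrices `A_I`. -/
def sqFn {d n : ℕ} (A : DCube d → Matrix (Fin n) (Fin n) ℂ)
    (f : (Fin d → ℝ) → EuclideanSpace ℂ (Fin n)) (x : Fin d → ℝ) : ℝ≥0∞ :=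
  ∑' I : DCube d, ∑ ε ∈ Sfin d,
    Set.indicator I.set
      (fun _ => ENNReal.ofReal (‖mApp (A I) (haarCoef f I ε)‖ ^ 2) / ENNReal.ofReal I.vol) x

/-! ## Stopping times -/

/-- A stopping time assigns to each dyadic cube `I` a collection `𝒥 I` of pairwise disjoint
dyadic subcubes of `I`. -/
def IsStopping {d : ℕ} (𝒥 : DCube d → Set (DCube d)) : Prop :=
  ∀ I : DCube d, (∀ J ∈ 𝒥 I, J.set ⊆ I.set) ∧
    (𝒥 I).Pairwise fun J K => Disjoint J.set K.set

/-- `ℱ(I)`: the dyadic subcubes of `I` not contained in any stopping cube `J ∈ 𝒥(I)`. -/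
def Fcol {d : ℕ} (𝒥 : DCube d → Set (DCube d)) (I : DCube d) : Set (DCube d) :=
  {J | J.set ⊆ I.set ∧ ∀ K ∈ 𝒥 I, ¬J.set ⊆ K.set}

/-- A stopping time is admissible if `I ∈ ℱ(I)` for every `I`. -/
def Admissible {d : ℕ} (𝒥 : DCube d → Set (DCube d)) : Prop :=
  ∀ I : DCube d, I ∈ Fcol 𝒥 I

/-- The iterated stopping collections: `𝒥^0(I) = {I}` and
`𝒥^{j+1}(I) = ⋃_{J ∈ 𝒥^j(I)} 𝒥(J)`. -/
def JIter {d : ℕ} (𝒥 : DCube d → Set (DCube d)) : ℕ → DCube d → Set (DCube d)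
  | 0, I => {I}
  | j + 1, I => ⋃ J ∈ JIter 𝒥 j I, 𝒥 J

/-- A stopping time is decaying with constant `c` if
`∑_{J ∈ 𝒥(I)} |J| ≤ c |I|` for every `I`. -/
def Decaying {d : ℕ} (c : ℝ) (𝒥 : DCube d → Set (DCube d)) : Prop :=
  ∀ I : DCube d,
    ∑' J : 𝒥 I, ENNReal.ofReal (J : DCube d).vol ≤ ENNReal.ofReal c * ENNReal.ofReal I.vol

/-- `ℱ^j = ℱ^j(I₀) = ⋃_{J ∈ 𝒥^{j-1}(I₀)} ℱ(J)` (intended for `j ≥ 1`). -/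
def Fj {d : ℕ} (𝒥 : DCube d → Set (DCube d)) (I₀ : DCube d) (j : ℕ) : Set (DCube d) :=
  ⋃ J ∈ JIter 𝒥 (j - 1) I₀, Fcol 𝒥 J

/-- The Haar projection `Δ_j f = ∑_{I ∈ ℱ^j} ∑_{ε ∈ 𝒮} f_I^ε h_I^ε`. -/
def deltaHaar {d n : ℕ} (𝒥 : DCube d → Set (DCube d)) (I₀ : DCube d) (j : ℕ)
    (f : (Fin d → ℝ) → EuclideanSpace ℂ (Fin n)) (x : Fin d → ℝ) :
    EuclideanSpace ℂ (Fin n) :=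
  ∑' I : Fj 𝒥 I₀ j, ∑ ε ∈ Sfin d, haarFn (I : DCube d) ε x • haarCoef f (I : DCube d) ε

/-! ## Constant Haar multipliers -/

/-- `∑_{I ∈ S} ∑_{ε ∈ 𝒮} V_I^{-1} f_I^ε h_I^ε(x)`. -/
def projInv {d n : ℕ} (V : DCube d → Matrix (Fin n) (Fin n) ℂ) (S : Set (DCube d))
    (f : (Fin d → ℝ) → EuclideanSpace ℂ (Fin n)) (x : Fin d → ℝ) :
    EuclideanSpace ℂ (Fin n) :=
  ∑' I : S, ∑ ε ∈ Sfin d,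
    haarFn (I : DCube d) ε x • mApp ((V (I : DCube d))⁻¹) (haarCoef f (I : DCube d) ε)

/-- A function has finite Haar expansion if it is a finite sum of Haar functions. -/
def FiniteHaar {d n : ℕ} (f : (Fin d → ℝ) → EuclideanSpace ℂ (Fin n)) : Prop :=
  ∃ F : Finset (DCube d × (Fin d → Bool)),
    ∀ x, f x = ∑ q ∈ F, haarFn q.1 q.2 x • haarCoef f q.1 q.2

/-! ## The weighted stopping time -/

/-- The stopping condition `‖V_J V_I^{-1}‖^p > λ₁` or `‖V_J^{-1} V_I‖^{p'} > λ₂`. -/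
def stopBad {d n : ℕ} (p l₁ l₂ : ℝ) (V : DCube d → Matrix (Fin n) (Fin n) ℂ)
    (J I : DCube d) : Prop :=
  l₁ < matNorm (V J * (V I)⁻¹) ^ p ∨ l₂ < matNorm ((V J)⁻¹ * V I) ^ (p / (p - 1))

/-- The stopping time `𝒥(I)` = maximal dyadic subcubes `J ⊆ I` satisfying `stopBad`. -/
def stopST {d n : ℕ} (p l₁ l₂ : ℝ) (V : DCube d → Matrix (Fin n) (Fin n) ℂ)
    (I : DCube d) : Set (DCube d) :=
  {J | J.set ⊆ I.set ∧ stopBad p l₁ l₂ V J I ∧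
    ∀ K : DCube d, K.set ⊆ I.set → stopBad p l₁ l₂ V K I → J.set ⊆ K.set → K = J}

lemma mApp_mul {n : ℕ} (A B : Matrix (Fin n) (Fin n) ℂ) (v : EuclideanSpace ℂ (Fin n)) :
    mApp (A * B) v = mApp A (mApp B v) := by
  simp [mApp]

lemma mApp_one {n : ℕ} (v : EuclideanSpace ℂ (Fin n)) : mApp 1 v = v := by
  simp [mApp]

lemma norm_mApp_le {n : ℕ} (A : Matrix (Fin n) (Fin n) ℂ) (v : EuclideanSpace ℂ (Fin n)) :
    ‖mApp A v‖ ≤ matNorm A * ‖v‖ :=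
  ContinuousLinearMap.le_opNorm _ _

lemma matNorm_nonneg {n : ℕ} (A : Matrix (Fin n) (Fin n) ℂ) : 0 ≤ matNorm A :=
  norm_nonneg _

lemma matNorm_mul_le {n : ℕ} (A B : Matrix (Fin n) (Fin n) ℂ) :
    matNorm (A * B) ≤ matNorm A * matNorm B := by
  simpa [matNorm] using norm_mul_le (Matrix.toEuclideanCLM (𝕜 := ℂ) A)
    (Matrix.toEuclideanCLM (𝕜 := ℂ) B)

lemma matNorm_conjTranspose {n : ℕ} (A : Matrix (Fin n) (Fin n) ℂ) :
    matNorm A.conjTranspose = matNorm A := by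
  unfold matNorm
  rw [← Matrix.star_eq_conjTranspose, map_star, ContinuousLinearMap.star_eq_adjoint,
    LinearIsometryEquiv.norm_map]

lemma matNorm_eq_zero {n : ℕ} {A : Matrix (Fin n) (Fin n) ℂ} (h : matNorm A = 0) : A = 0 := by
  unfold matNorm at h
  rw [norm_eq_zero] at h
  simpa using h

lemma matNorm_one_le {n : ℕ} : matNorm (1 : Matrix (Fin n) (Fin n) ℂ) ≤ 1 := by
  unfold matNorm
  rw [map_one]
  exact ContinuousLinearMap.norm_id_le

lemma matNorm_le_sum {n : ℕ} (A : Matrix (Fin n) (Fin n) ℂ) :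
    matNorm A ≤ ∑ i, ‖mApp A (EuclideanSpace.single i 1)‖ := by
  refine ContinuousLinearMap.opNorm_le_bound _ (Finset.sum_nonneg fun _ _ => norm_nonneg _) ?_
  intro v
  have hv : v = ∑ i, v i • EuclideanSpace.single i (1 : ℂ) := by
    ext j
    simp [Finset.sum_apply, Pi.single_apply]
  have : (Matrix.toEuclideanCLM (𝕜 := ℂ) A) v
      = ∑ i, v i • mApp A (EuclideanSpace.single i 1) := by
    conv_lhs => rw [hv]
    rw [map_sum]
    refine Finset.sum_congr rfl fun i _ => ?_
    rw [map_smul]; rfl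
  rw [this, Finset.sum_mul]
  refine (norm_sum_le _ _).trans (Finset.sum_le_sum fun i _ => ?_)
  rw [norm_smul, mul_comm]
  exact mul_le_mul_of_nonneg_left (PiLp.norm_apply_le v i) (norm_nonneg _)

lemma Matrix.PosDef.mul_inv_self {n : ℕ} {A : Matrix (Fin n) (Fin n) ℂ} (h : A.PosDef) :
    A * A⁻¹ = 1 :=
  Matrix.mul_nonsing_inv _ ((Matrix.isUnit_iff_isUnit_det _).1 h.isUnit)

lemma Matrix.PosDef.inv_mul_self {n : ℕ} {A : Matrix (Fin n) (Fin n) ℂ} (h : A.PosDef) :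
    A⁻¹ * A = 1 :=
  Matrix.nonsing_inv_mul _ ((Matrix.isUnit_iff_isUnit_det _).1 h.isUnit)

lemma matNorm_mul_comm_of_isHermitian {n : ℕ} {A B : Matrix (Fin n) (Fin n) ℂ}
    (hA : A.IsHermitian) (hB : B.IsHermitian) : matNorm (A * B) = matNorm (B * A) := by
  rw [← matNorm_conjTranspose, Matrix.conjTranspose_mul, hA.eq, hB.eq]

lemma inner_mApp_left {n : ℕ} {A : Matrix (Fin n) (Fin n) ℂ} (hA : A.IsHermitian)
    (v w : EuclideanSpace ℂ (Fin n)) : inner ℂ (mApp A v) w = inner ℂ v (mApp A w) := by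
  have h : star (Matrix.toEuclideanCLM (𝕜 := ℂ) A) = Matrix.toEuclideanCLM (𝕜 := ℂ) A := by
    rw [← map_star, Matrix.star_eq_conjTranspose, hA.eq]
  unfold mApp
  conv_lhs => rw [← h, ContinuousLinearMap.star_eq_adjoint,
    ContinuousLinearMap.adjoint_inner_left]

lemma continuous_matNorm {n : ℕ} :
    Continuous fun A : Matrix (Fin n) (Fin n) ℂ => matNorm A := by
  have : Continuous fun A : Matrix (Fin n) (Fin n) ℂ => Matrix.toEuclideanCLM (𝕜 := ℂ) A :=
    LinearMap.continuous_of_finiteDimensional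
      (Matrix.toEuclideanCLM (𝕜 := ℂ) (n := Fin n)).toAlgEquiv.toLinearMap
  exact this.norm

lemma measurable_matNorm_comp {α : Type*} [MeasurableSpace α] {n : ℕ}
    {F : α → Matrix (Fin n) (Fin n) ℂ} (hF : ∀ i j, Measurable fun x => F x i j) :
    Measurable fun x => matNorm (F x) := by
  have : BorelSpace (Fin n → Fin n → ℂ) := Pi.borelSpace
  have h0 : Continuous (fun A : Fin n → Fin n → ℂ => matNorm (Matrix.of A)) :=
    continuous_matNorm (n := n)
  have h1 := h0.measurable
  exact h1.comp (measurable_pi_iff.2 fun i => measurable_pi_iff.2 fun j => hF i j)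

lemma measurable_mul_entry {α : Type*} [MeasurableSpace α] {n : ℕ}
    {F G : α → Matrix (Fin n) (Fin n) ℂ} (hF : ∀ i j, Measurable fun x => F x i j)
    (hG : ∀ i j, Measurable fun x => G x i j) (i j : Fin n) :
    Measurable fun x => (F x * G x) i j := by
  simp only [Matrix.mul_apply]
  exact Finset.measurable_sum _ fun k _ => (hF i k).mul (hG k j)

lemma measurable_inv_entry {α : Type*} [MeasurableSpace α] {n : ℕ}
    {F : α → Matrix (Fin n) (Fin n) ℂ} (hF : ∀ i j, Measurable fun x => F x i j)
    (i j : Fin n) : Measurable fun x => (F x)⁻¹ i j := by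
  have hF' : Measurable fun x => (fun i j => F x i j : Fin n → Fin n → ℂ) :=
    measurable_pi_iff.2 fun i => measurable_pi_iff.2 fun j => hF i j
  have : BorelSpace (Fin n → Fin n → ℂ) := Pi.borelSpace
  have h1 : Continuous (fun A : Fin n → Fin n → ℂ => (Matrix.of A).det) :=
    Continuous.matrix_det (A := fun A : Fin n → Fin n → ℂ => Matrix.of A) continuous_id
  have h2 : Continuous (fun A : Fin n → Fin n → ℂ => (Matrix.of A).adjugate i j) :=
    Continuous.matrix_elem (Continuous.matrix_adjugate
      (A := fun A : Fin n → Fin n → ℂ => Matrix.of A) continuous_id) i j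
  have : (fun x => (F x)⁻¹ i j) = fun x => ((F x).det)⁻¹ * (F x).adjugate i j := by
    funext x
    rw [Matrix.inv_def, Ring.inverse_eq_inv']
    simp
  rw [this]
  exact (h1.measurable.comp hF').inv.mul (h2.measurable.comp hF')

lemma measurable_mApp_comp {α : Type*} [MeasurableSpace α] {n : ℕ}
    {F : α → Matrix (Fin n) (Fin n) ℂ} (hF : ∀ i j, Measurable fun x => F x i j)
    {f : α → EuclideanSpace ℂ (Fin n)} (hf : Measurable f) :
    Measurable fun x => mApp (F x) (f x) := by
  have h0 : ∀ j, Measurable fun x => f x j := fun j =>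
    (EuclideanSpace.proj (𝕜 := ℂ) j).continuous.measurable.comp hf
  have : (fun x => mApp (F x) (f x)) = fun x => WithLp.toLp 2 (fun i => ∑ j, F x i j * f x j) := by
    funext x
    ext i
    simp [mApp, Matrix.mulVec, dotProduct]
  rw [this]
  refine (WithLp.measurable_toLp 2 _).comp (measurable_pi_iff.2 fun i => ?_)
  exact Finset.measurable_sum _ fun j _ => (hF i j).mul (h0 j)

namespace DCube

variable {d : ℕ}

lemma vol_pos (I : DCube d) : 0 < I.vol := by unfold vol; positivity

lemma set_eq_pi (I : DCube d) :
    I.set = Set.univ.pi fun i => Set.Ico ((I.m i : ℝ) * 2 ^ I.k) (((I.m i : ℝ) + 1) * 2 ^ I.k) := by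
  ext x; simp [set, Set.mem_pi]

lemma measurableSet_set (I : DCube d) : MeasurableSet I.set := by
  rw [set_eq_pi]
  exact MeasurableSet.univ_pi fun i => measurableSet_Ico

lemma volume_set (I : DCube d) : volume I.set = ENNReal.ofReal I.vol := by
  rw [set_eq_pi, Real.volume_pi_Ico]
  have : ∀ i, ((I.m i : ℝ) + 1) * 2 ^ I.k - (I.m i : ℝ) * 2 ^ I.k = 2 ^ I.k := fun i => by ring
  simp only [this, Finset.prod_const, Finset.card_univ, Fintype.card_fin, vol]
  rw [ENNReal.ofReal_pow (by positivity)]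

lemma volume_set_ne_zero (I : DCube d) : volume I.set ≠ 0 := by
  rw [volume_set]; simpa using I.vol_pos

lemma volume_set_ne_top (I : DCube d) : volume I.set ≠ ⊤ := by
  rw [volume_set]; exact ENNReal.ofReal_ne_top

lemma corner_mem (I : DCube d) : I.corner ∈ I.set := by
  intro i
  have : (0 : ℝ) < 2 ^ I.k := by positivity
  refine ⟨le_rfl, ?_⟩
  simp only [corner]
  nlinarith

instance : Countable (DCube d) := by
  refine Function.Injective.countable (f := fun I : DCube d => (I.k, I.m)) ?_
  rintro ⟨k, m⟩ ⟨k', m'⟩ h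
  simp only [Prod.mk.injEq] at h
  rw [h.1, h.2]

/-- The dyadic cube of side `2 ^ k` containing the point `x`. -/
def containing (k : ℤ) (x : Fin d → ℝ) : DCube d := ⟨k, fun i => ⌊x i / 2 ^ k⌋⟩

lemma mem_set_iff {I : DCube d} {x : Fin d → ℝ} : x ∈ I.set ↔ I = containing I.k x := by
  have h2 : (0 : ℝ) < 2 ^ I.k := by positivity
  have key : ∀ i, ((I.m i : ℝ) * 2 ^ I.k ≤ x i ∧ x i < ((I.m i : ℝ) + 1) * 2 ^ I.k) ↔
      I.m i = ⌊x i / 2 ^ I.k⌋ := by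
    intro i
    rw [eq_comm, Int.floor_eq_iff, le_div_iff₀ h2, div_lt_iff₀ h2]
  simp only [set, Set.mem_ofPred_eq, key]
  constructor
  · intro h
    cases I
    simp only [containing, mk.injEq, true_and]
    exact funext h
  · intro h i
    exact congrFun (congrArg m h) i

lemma mem_containing (k : ℤ) (x : Fin d → ℝ) : x ∈ (containing k x).set :=
  mem_set_iff.2 rfl

lemma eq_of_mem {I J : DCube d} (hk : I.k = J.k) {x : Fin d → ℝ} (hI : x ∈ I.set)
    (hJ : x ∈ J.set) : I = J := by
  rw [mem_set_iff.1 hI, mem_set_iff.1 hJ, hk]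

lemma subset_of_mem {I J : DCube d} (hk : I.k ≤ J.k) {x : Fin d → ℝ} (hI : x ∈ I.set)
    (hJ : x ∈ J.set) : I.set ⊆ J.set := by
  obtain ⟨e, he⟩ := Int.eq_ofNat_of_zero_le (sub_nonneg.2 hk)
  have hJk : (2 : ℝ) ^ J.k = 2 ^ I.k * 2 ^ e := by
    rw [show J.k = I.k + (e : ℤ) by omega, zpow_add₀ two_ne_zero, zpow_natCast]
  have h2 : (0 : ℝ) < 2 ^ I.k := by positivity
  intro y hy i
  obtain ⟨a1, a2⟩ := hI i
  obtain ⟨b1, b2⟩ := hJ i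
  obtain ⟨c1, c2⟩ := hy i
  rw [hJk] at b1 b2 ⊢
  have l1 : J.m i * 2 ^ e ≤ I.m i := by
    rw [← Int.lt_add_one_iff]
    have : (J.m i * 2 ^ e : ℝ) * 2 ^ I.k < (I.m i + 1) * 2 ^ I.k := by nlinarith
    exact_mod_cast lt_of_mul_lt_mul_right this h2.le
  have l2 : I.m i + 1 ≤ (J.m i + 1) * 2 ^ e := by
    rw [Int.add_one_le_iff]
    have : (I.m i : ℝ) * 2 ^ I.k < ((J.m i + 1) * 2 ^ e : ℝ) * 2 ^ I.k := by nlinarith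
    exact_mod_cast lt_of_mul_lt_mul_right this h2.le
  have l1' : (J.m i * 2 ^ e : ℝ) ≤ I.m i := by exact_mod_cast l1
  have l2' : (I.m i + 1 : ℝ) ≤ (J.m i + 1) * 2 ^ e := by exact_mod_cast l2
  constructor <;> nlinarith

lemma subset_or_disjoint {I J : DCube d} (hk : I.k ≤ J.k) :
    I.set ⊆ J.set ∨ Disjoint I.set J.set := by
  by_cases h : Disjoint I.set J.set
  · exact Or.inr h
  · obtain ⟨x, hI, hJ⟩ := Set.not_disjoint_iff.1 h
    exact Or.inl (subset_of_mem hk hI hJ)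

lemma k_le_of_subset (hd : 0 < d) {I J : DCube d} (h : I.set ⊆ J.set) : I.k ≤ J.k := by
  have := measure_mono (μ := volume) h
  rw [volume_set, volume_set, ENNReal.ofReal_le_ofReal_iff J.vol_pos.le] at this
  have h3 := (pow_le_pow_iff_left₀ (by positivity) (by positivity) hd.ne').1 this
  exact (zpow_le_zpow_iff_right₀ (by norm_num)).1 h3

lemma eq_of_subset {I J : DCube d} (h : I.set ⊆ J.set) (hk : I.k = J.k) : I = J :=
  eq_of_mem hk I.corner_mem (h I.corner_mem)

lemma k_lt_of_subset (hd : 0 < d) {I J : DCube d} (h : I.set ⊆ J.set) (hne : I ≠ J) :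
    I.k < J.k :=
  lt_of_le_of_ne (k_le_of_subset hd h) fun hk => hne (eq_of_subset h hk)

/-- The dyadic children of a cube, indexed by `{0,1}^d`. -/
def child (I : DCube d) (η : Fin d → Bool) : DCube d :=
  ⟨I.k - 1, fun i => 2 * I.m i + if η i then 1 else 0⟩

lemma two_zpow_sub_one (k : ℤ) : (2 : ℝ) ^ (k - 1) = 2 ^ k / 2 := by
  rw [zpow_sub_one₀ two_ne_zero]; rfl

lemma mem_child_iff {I : DCube d} {η : Fin d → Bool} {x : Fin d → ℝ} :
    x ∈ (I.child η).set ↔ ∀ i,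
      ((I.m i : ℝ) + if η i then 1 / 2 else 0) * 2 ^ I.k ≤ x i ∧
      x i < ((I.m i : ℝ) + if η i then 1 else 1 / 2) * 2 ^ I.k := by
  simp only [set, child, Set.mem_ofPred_eq, two_zpow_sub_one]
  refine forall_congr' fun i => ?_
  have e1 : ((2 * I.m i + (if η i then 1 else 0) : ℤ) : ℝ) * (2 ^ I.k / 2) =
      ((I.m i : ℝ) + if η i then 1 / 2 else 0) * 2 ^ I.k := by
    split_ifs <;> push_cast <;> ring
  have e2 : (((2 * I.m i + (if η i then 1 else 0) : ℤ) : ℝ) + 1) * (2 ^ I.k / 2) =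
      ((I.m i : ℝ) + if η i then 1 else 1 / 2) * 2 ^ I.k := by
    split_ifs <;> push_cast <;> ring
  rw [e1, e2]

lemma child_subset (I : DCube d) (η : Fin d → Bool) : (I.child η).set ⊆ I.set := by
  intro x hx i
  have h2 : (0 : ℝ) < 2 ^ I.k := by positivity
  have := mem_child_iff.1 hx i
  split_ifs at this <;> constructor <;> nlinarith [this.1, this.2]

lemma exists_mem_child {I : DCube d} {x : Fin d → ℝ} (hx : x ∈ I.set) :
    ∃ η, x ∈ (I.child η).set := by
  refine ⟨fun i => decide (((I.m i : ℝ) + 1 / 2) * 2 ^ I.k ≤ x i), mem_child_iff.2 fun i => ?_⟩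
  have := hx i
  by_cases h : ((I.m i : ℝ) + 1 / 2) * 2 ^ I.k ≤ x i
  · rw [decide_eq_true h]; simpa using ⟨by simpa using h, this.2⟩
  · rw [decide_eq_false h]; simpa using ⟨this.1, by simpa using h⟩

lemma iUnion_child (I : DCube d) : ⋃ η, (I.child η).set = I.set := by
  refine Set.Subset.antisymm (Set.iUnion_subset fun η => I.child_subset η) fun x hx => ?_
  exact Set.mem_iUnion.2 (exists_mem_child hx)

lemma child_injective (I : DCube d) : Function.Injective I.child := by
  intro η η' h
  have h := congrArg m h
  funext i
  have h := congrFun h i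
  simp only [child] at h
  cases hη : η i <;> cases hη' : η' i <;> simp_all

lemma disjoint_of_ne {I J : DCube d} (hk : I.k = J.k) (h : I ≠ J) : Disjoint I.set J.set :=
  Set.disjoint_left.2 fun _ hI hJ => h (eq_of_mem hk hI hJ)

lemma pairwise_disjoint_child (I : DCube d) :
    Pairwise (Function.onFun Disjoint fun η => (I.child η).set) :=
  fun _ _ h => disjoint_of_ne rfl fun h' => h (I.child_injective h')

lemma volume_child (I : DCube d) (η : Fin d → Bool) :
    2 ^ d * volume (I.child η).set = volume I.set := by
  have : I.vol = 2 ^ d * (I.child η).vol := by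
    simp only [vol, child, two_zpow_sub_one, ← mul_pow]
    congr 1; ring
  rw [volume_set, volume_set, this, ENNReal.ofReal_mul (by positivity)]
  simp

lemma exists_subset_child (hd : 0 < d) {I J : DCube d} (h : J.set ⊆ I.set) (hne : J ≠ I) :
    ∃ η, J.set ⊆ (I.child η).set := by
  obtain ⟨η, hη⟩ := exists_mem_child (h J.corner_mem)
  refine ⟨η, subset_of_mem ?_ J.corner_mem hη⟩
  have := k_lt_of_subset hd h hne
  simp only [child]; omega

/-- The maximal cubes of a family of dyadic cubes. -/
def maximals (B : Set (DCube d)) : Set (DCube d) :=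
  {J | J ∈ B ∧ ∀ K ∈ B, J.set ⊆ K.set → K = J}

lemma maximals_subset (B : Set (DCube d)) : maximals B ⊆ B := fun _ h => h.1

lemma pairwise_disjoint_maximals (B : Set (DCube d)) :
    Pairwise (Function.onFun Disjoint fun J : maximals B => (J : DCube d).set) := by
  rintro ⟨J, hJ, hJ'⟩ ⟨K, hK, hK'⟩ hne
  have hne' : J ≠ K := fun h => hne (Subtype.ext h)
  rcases le_total J.k K.k with h | h
  · exact (subset_or_disjoint h).resolve_left fun h' => hne' (hJ' K hK h').symm
  · exact ((subset_or_disjoint h).resolve_left fun h' => hne' (hK' J hJ h')).symm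

lemma exists_maximal_superset (hd : 0 < d) {B : Set (DCube d)} {N : ℤ}
    (hB : ∀ J ∈ B, J.k ≤ N) {J : DCube d} (hJ : J ∈ B) :
    ∃ K ∈ maximals B, J.set ⊆ K.set := by
  obtain ⟨r, hr⟩ := Int.eq_ofNat_of_zero_le (sub_nonneg.2 (hB J hJ))
  induction r using Nat.strong_induction_on generalizing J with
  | _ r ih =>
    by_cases h : ∃ K ∈ B, J.set ⊆ K.set ∧ K ≠ J
    · obtain ⟨K, hK, hJK, hne⟩ := h
      have hlt := k_lt_of_subset hd hJK hne.symm
      have hKN := hB K hK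
      obtain ⟨M, hM, hKM⟩ := ih (N - K.k).toNat (by omega) hK (by omega)
      exact ⟨M, hM, hJK.trans hKM⟩
    · push Not at h
      exact ⟨J, ⟨hJ, h⟩, subset_rfl⟩

lemma iUnion_maximals (hd : 0 < d) {B : Set (DCube d)} {N : ℤ} (hB : ∀ J ∈ B, J.k ≤ N) :
    ⋃ J : maximals B, (J : DCube d).set = ⋃ J ∈ B, J.set := by
  apply Set.Subset.antisymm
  · exact Set.iUnion_subset fun J => Set.subset_biUnion_of_mem (u := fun J : DCube d => J.set) J.2.1
  · refine Set.iUnion₂_subset fun J hJ => ?_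
    obtain ⟨K, hK, h⟩ := exists_maximal_superset hd hB hJ
    exact h.trans (Set.subset_iUnion (fun J : maximals B => (J : DCube d).set) ⟨K, hK⟩)

/-- Weak type estimate for unions of dyadic cubes on which `u` has large average. -/
lemma mul_volume_biUnion_le (hd : 0 < d) {B : Set (DCube d)} {Q : DCube d}
    (hB : ∀ J ∈ B, J.set ⊆ Q.set) {c : ℝ≥0∞} {u : (Fin d → ℝ) → ℝ≥0∞}
    (h : ∀ J ∈ B, c * volume J.set ≤ ∫⁻ x in J.set, u x) :
    c * volume (⋃ J ∈ B, J.set) ≤ ∫⁻ x in Q.set, u x := by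
  rw [← iUnion_maximals hd (N := Q.k) fun J hJ => k_le_of_subset hd (hB J hJ),
    measure_iUnion (pairwise_disjoint_maximals B) fun J => J.1.measurableSet_set,
    ← ENNReal.tsum_mul_left]
  calc ∑' J : maximals B, c * volume (J : DCube d).set
      ≤ ∑' J : maximals B, ∫⁻ x in (J : DCube d).set, u x :=
        ENNReal.tsum_le_tsum fun J => h J J.2.1
    _ = ∫⁻ x in ⋃ J : maximals B, (J : DCube d).set, u x :=
        (lintegral_iUnion (fun J => J.1.measurableSet_set) (pairwise_disjoint_maximals B) _).symm
    _ ≤ _ := lintegral_mono_set (Set.iUnion_subset fun J => hB J J.2.1)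

end DCube

/-- The sign of the Haar function of signature `ε` on the child `η`, in dimension one. -/
def haarSign1D (ε b : Bool) : ℝ := if ε then 1 else if b then -1 else 1

/-- The sign of the Haar function of signature `ε` on the child `η`. -/
def haarSign {d : ℕ} (ε η : Fin d → Bool) : ℝ := ∏ i, haarSign1D (ε i) (η i)

lemma haarSign_sq {d : ℕ} (ε η : Fin d → Bool) : haarSign ε η ^ 2 = 1 := by
  unfold haarSign
  rw [← Finset.prod_pow]
  refine Finset.prod_eq_one fun i _ => ?_
  unfold haarSign1D
  split_ifs <;> norm_num

lemma sum_haarSign {d : ℕ} {ε : Fin d → Bool} (hε : ε ∈ Sfin d) : ∑ η, haarSign ε η = 0 := by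
  unfold haarSign
  rw [← Fintype.prod_sum]
  have : ∃ i, ε i = false := by
    by_contra! h
    simp only [Sfin, Finset.mem_erase] at hε
    exact hε.1 (funext fun i => by simpa using h i)
  obtain ⟨i, hi⟩ := this
  refine Finset.prod_eq_zero (Finset.mem_univ i) ?_
  simp [haarSign1D, hi]

lemma haar1D_of_mem {ε b : Bool} {k m : ℤ} {t : ℝ}
    (h : ((m : ℝ) + if b then 1 / 2 else 0) * 2 ^ k ≤ t ∧
      t < ((m : ℝ) + if b then 1 else 1 / 2) * 2 ^ k) :
    haar1D ε k m t = ((2 : ℝ) ^ k) ^ (-(1 / 2 : ℝ)) * haarSign1D ε b := by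
  have h2 : (0 : ℝ) < 2 ^ k := by positivity
  unfold haar1D haarSign1D
  rw [DCube.two_zpow_sub_one]
  cases ε <;> cases b <;>
    simp only [if_true, if_false, Bool.false_eq_true, Set.indicator, Set.mem_ofPred_eq] at h ⊢
  · rw [if_pos ⟨by linarith [h.1], by linarith [h.2]⟩, if_neg (by intro h'; linarith [h.2, h'.1])]
    ring
  · rw [if_neg (by intro h'; linarith [h.1, h'.2]), if_pos ⟨by linarith [h.1], by linarith [h.2]⟩]
    ring
  · rw [if_pos ⟨by linarith [h.1], by linarith [h.2]⟩]
    ring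
  · rw [if_pos ⟨by linarith [h.1], by linarith [h.2]⟩]
    ring

lemma haar1D_of_not_mem {ε : Bool} {k m : ℤ} {t : ℝ}
    (h : ¬((m : ℝ) * 2 ^ k ≤ t ∧ t < ((m : ℝ) + 1) * 2 ^ k)) : haar1D ε k m t = 0 := by
  have h2 : (0 : ℝ) < 2 ^ k := by positivity
  unfold haar1D
  rw [DCube.two_zpow_sub_one]
  cases ε <;> simp only [if_true, if_false, Bool.false_eq_true, Set.indicator, Set.mem_ofPred_eq]
  · rw [if_neg (fun h' => h ⟨by linarith [h'.1], by linarith [h'.2]⟩),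
      if_neg (fun h' => h ⟨by linarith [h'.1], by linarith [h'.2]⟩), sub_zero]
  · rw [if_neg h]

lemma haarFn_of_mem_child {d : ℕ} {I : DCube d} {ε η : Fin d → Bool} {x : Fin d → ℝ}
    (hx : x ∈ (I.child η).set) :
    haarFn I ε x = (((2 : ℝ) ^ I.k) ^ (-(1 / 2 : ℝ))) ^ d * haarSign ε η := by
  unfold haarFn haarSign
  rw [Finset.prod_congr rfl fun i _ => haar1D_of_mem (DCube.mem_child_iff.1 hx i),
    Finset.prod_mul_distrib]
  simp

lemma haarFn_of_not_mem {d : ℕ} {I : DCube d} {ε : Fin d → Bool} {x : Fin d → ℝ}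
    (hx : x ∉ I.set) : haarFn I ε x = 0 := by
  have : ∃ i, ¬((I.m i : ℝ) * 2 ^ I.k ≤ x i ∧ x i < ((I.m i : ℝ) + 1) * 2 ^ I.k) := by
    by_contra! h
    exact hx h
  obtain ⟨i, hi⟩ := this
  exact Finset.prod_eq_zero (Finset.mem_univ i) (haar1D_of_not_mem hi)

lemma haar_normalization {d : ℕ} (I : DCube d) :
    ((((2 : ℝ) ^ I.k) ^ (-(1 / 2 : ℝ))) ^ d) ^ 2 = (I.vol)⁻¹ := by
  have h2 : (0 : ℝ) < 2 ^ I.k := by positivity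
  rw [← pow_mul, mul_comm d 2, pow_mul, ← Real.rpow_natCast _ 2, ← Real.rpow_mul h2.le,
    DCube.vol, ← inv_pow]
  norm_num
  rw [Real.rpow_neg_one, inv_pow]

lemma integral_eq_sum_child {d n : ℕ} {I : DCube d}
    {g : (Fin d → ℝ) → EuclideanSpace ℂ (Fin n)} (hg : IntegrableOn g I.set) :
    ∫ x in I.set, g x = ∑ η, ∫ x in (I.child η).set, g x := by
  rw [← I.iUnion_child] at hg ⊢
  exact integral_iUnion_fintype (fun η => (I.child η).measurableSet_set)
    I.pairwise_disjoint_child fun η =>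
      hg.mono_set (Set.subset_iUnion (fun η => (I.child η).set) η)

lemma haarCoef_eq_sum_child {d n : ℕ} {I : DCube d}
    {g : (Fin d → ℝ) → EuclideanSpace ℂ (Fin n)} (hg : IntegrableOn g I.set)
    (ε : Fin d → Bool) :
    haarCoef g I ε = (((2 : ℝ) ^ I.k) ^ (-(1 / 2 : ℝ))) ^ d •
      ∑ η, haarSign ε η • ∫ x in (I.child η).set, g x := by
  unfold haarCoef
  have hz : ∀ x, x ∉ I.set → haarFn I ε x • g x = 0 := fun x hx => by
    rw [haarFn_of_not_mem hx, zero_smul]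
  have hc : ∀ η, Set.EqOn (fun x => haarFn I ε x • g x)
      (fun x => ((((2 : ℝ) ^ I.k) ^ (-(1 / 2 : ℝ))) ^ d * haarSign ε η) • g x)
      (I.child η).set := fun η x hx => by
    simp only [haarFn_of_mem_child hx]
  rw [← setIntegral_eq_integral_of_forall_compl_eq_zero hz, ← I.iUnion_child,
    integral_iUnion_fintype (fun η => (I.child η).measurableSet_set) I.pairwise_disjoint_child,
    Finset.smul_sum]
  · refine Finset.sum_congr rfl fun η _ => ?_
    rw [setIntegral_congr_fun (I.child η).measurableSet_set (hc η), integral_smul, smul_smul]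
  · intro η
    refine IntegrableOn.congr_fun ?_ (hc η).symm (I.child η).measurableSet_set
    have h1 : IntegrableOn g (I.child η).set := hg.mono_set (I.child_subset η)
    exact Integrable.smul ((((2 : ℝ) ^ I.k) ^ (-(1 / 2 : ℝ))) ^ d * haarSign ε η) h1

lemma norm_sq_sign_sum_add_le {ι E : Type*} [Fintype ι] [NormedAddCommGroup E]
    [InnerProductSpace ℝ E] (G : ι → E) (s : ι → ℝ) (hs : ∀ i, s i ^ 2 = 1)
    (h0 : ∑ i, s i = 0) :
    ‖∑ i, s i • G i‖ ^ 2 + ‖∑ i, G i‖ ^ 2 ≤ Fintype.card ι * ∑ i, ‖G i‖ ^ 2 := by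
  have key : ∀ w : ι → ℝ, (∀ i, w i ^ 2 = w i) →
      ‖∑ i, w i • G i‖ ^ 2 ≤ (∑ i, w i) * ∑ i, w i * ‖G i‖ ^ 2 := by
    intro w hw
    have hw0 : ∀ i, 0 ≤ w i := fun i => hw i ▸ sq_nonneg (w i)
    calc ‖∑ i, w i • G i‖ ^ 2 ≤ (∑ i, w i * (w i * ‖G i‖)) ^ 2 := by
          gcongr
          refine (norm_sum_le _ _).trans (le_of_eq (Finset.sum_congr rfl fun i _ => ?_))
          rw [norm_smul, Real.norm_of_nonneg (hw0 i), ← mul_assoc, ← pow_two, hw]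
      _ ≤ (∑ i, w i ^ 2) * ∑ i, (w i * ‖G i‖) ^ 2 := Finset.sum_mul_sq_le_sq_mul_sq _ _ _
      _ = _ := by simp only [mul_pow, hw]
  have hA := key (fun i => (1 + s i) / 2) fun i => by linear_combination hs i / 4
  have hB := key (fun i => (1 - s i) / 2) fun i => by linear_combination hs i / 4
  have sA : ∑ i, (1 + s i) / 2 = (Fintype.card ι : ℝ) / 2 := by
    rw [← Finset.sum_div, Finset.sum_add_distrib, h0]; simp
  have sB : ∑ i, (1 - s i) / 2 = (Fintype.card ι : ℝ) / 2 := by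
    rw [← Finset.sum_div, Finset.sum_sub_distrib, h0]; simp
  rw [sA] at hA
  rw [sB] at hB
  have eAB : ∑ i, (1 + s i) / 2 * ‖G i‖ ^ 2 + ∑ i, (1 - s i) / 2 * ‖G i‖ ^ 2
      = ∑ i, ‖G i‖ ^ 2 := by
    rw [← Finset.sum_add_distrib]
    exact Finset.sum_congr rfl fun i _ => by ring
  have p := parallelogram_law_with_norm ℝ (∑ i, ((1 + s i) / 2) • G i)
    (∑ i, ((1 - s i) / 2) • G i)
  rw [← Finset.sum_add_distrib, ← Finset.sum_sub_distrib] at p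
  have e1 : ∀ i, ((1 + s i) / 2) • G i + ((1 - s i) / 2) • G i = G i := fun i => by
    rw [← add_smul]
    convert one_smul ℝ (G i) using 2
    ring
  have e2 : ∀ i, ((1 + s i) / 2) • G i - ((1 - s i) / 2) • G i = s i • G i := fun i => by
    rw [← sub_smul]
    congr 1
    ring
  simp only [e1, e2] at p
  rw [← eAB]
  nlinarith

lemma haarCoef_norm_sq_add_le {d n : ℕ} {I : DCube d}
    {g : (Fin d → ℝ) → EuclideanSpace ℂ (Fin n)} (hg : IntegrableOn g I.set)
    {ε : Fin d → Bool} (hε : ε ∈ Sfin d) :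
    ‖haarCoef g I ε‖ ^ 2 + ‖∫ x in I.set, g x‖ ^ 2 / I.vol ≤
      ∑ η, ‖∫ x in (I.child η).set, g x‖ ^ 2 / (I.child η).vol := by
  have hv : ∀ η, (I.child η).vol = I.vol / 2 ^ d := fun η => by
    simp only [DCube.vol, DCube.child, DCube.two_zpow_sub_one, div_pow]
  have h := norm_sq_sign_sum_add_le (fun η => ∫ x in (I.child η).set, g x)
    (haarSign ε) (haarSign_sq ε) (sum_haarSign hε)
  rw [haarCoef_eq_sum_child hg, integral_eq_sum_child hg, norm_smul, mul_pow, Real.norm_eq_abs,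
    sq_abs, haar_normalization]
  simp only [hv]
  have hI := I.vol_pos
  rw [← Finset.sum_div]
  have hc : (Fintype.card (Fin d → Bool) : ℝ) = 2 ^ d := by simp
  rw [hc] at h
  rw [div_div_eq_mul_div, inv_mul_eq_div, ← add_div]
  gcongr
  linarith

/-- The total Haar energy `∑_{ε ∈ 𝒮} |g_I^ε|²` of `g` at the cube `I`. -/
def haarEnergy {d n : ℕ} (g : (Fin d → ℝ) → EuclideanSpace ℂ (Fin n)) (I : DCube d) : ℝ≥0∞ :=
  ∑ ε ∈ Sfin d, ENNReal.ofReal (‖haarCoef g I ε‖ ^ 2)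

/-- The energy `|I| |⟨g⟩_I|²` of the average of `g` over the cube `I`. -/
def meanEnergy {d n : ℕ} (g : (Fin d → ℝ) → EuclideanSpace ℂ (Fin n)) (I : DCube d) : ℝ≥0∞ :=
  ENNReal.ofReal (‖∫ x in I.set, g x‖ ^ 2 / I.vol)

lemma haarEnergy_add_le {d n : ℕ} {I : DCube d}
    {g : (Fin d → ℝ) → EuclideanSpace ℂ (Fin n)} (hg : IntegrableOn g I.set) :
    haarEnergy g I + (Sfin d).card * meanEnergy g I ≤
      (Sfin d).card * ∑ η, meanEnergy g (I.child η) := by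
  unfold haarEnergy
  rw [← nsmul_eq_mul, ← nsmul_eq_mul, ← Finset.sum_const, ← Finset.sum_const,
    ← Finset.sum_add_distrib]
  refine Finset.sum_le_sum fun ε hε => ?_
  have hI := I.vol_pos
  unfold meanEnergy
  rw [← ENNReal.ofReal_add (by positivity) (by positivity),
    ← ENNReal.ofReal_sum_of_nonneg fun η _ => div_nonneg (by positivity) (I.child η).vol_pos.le]
  exact ENNReal.ofReal_le_ofReal (haarCoef_norm_sq_add_le hg hε)

lemma meanEnergy_le {d n : ℕ} {I : DCube d}
    {g : (Fin d → ℝ) → EuclideanSpace ℂ (Fin n)} {Λ : ℝ≥0∞}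
    (h : ∫⁻ x in I.set, ‖g x‖ₑ ≤ Λ * volume I.set) :
    meanEnergy g I ≤ Λ * ∫⁻ x in I.set, ‖g x‖ₑ := by
  unfold meanEnergy
  rw [ENNReal.ofReal_div_of_pos I.vol_pos, ENNReal.ofReal_pow (norm_nonneg _), ofReal_norm,
    ← DCube.volume_set]
  refine ENNReal.div_le_of_le_mul ?_
  have h1 := enorm_integral_le_lintegral_enorm (μ := volume.restrict I.set) g
  calc ‖∫ x in I.set, g x‖ₑ ^ 2 ≤ (∫⁻ x in I.set, ‖g x‖ₑ) ^ 2 := by gcongr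
    _ ≤ (Λ * volume I.set) * ∫⁻ x in I.set, ‖g x‖ₑ := by
        rw [pow_two]; gcongr
    _ = _ := by ring

/-- Energy estimate for a dyadic martingale stopped when its averages become large. -/
lemma tsum_haarEnergy_add_le {d n : ℕ} (hd : 0 < d) {Q : DCube d}
    {g : (Fin d → ℝ) → EuclideanSpace ℂ (Fin n)} (hg : IntegrableOn g Q.set)
    {F : Set (DCube d)} {N : ℤ} {Λ : ℝ≥0∞}
    (hF : ∀ J ∈ F, J.set ⊆ Q.set → ∫⁻ x in J.set, ‖g x‖ₑ ≤ Λ * volume J.set)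
    (hF' : ∀ I J : DCube d, J ∈ F → J.set ⊆ I.set → I.set ⊆ Q.set → I ∈ F)
    {I : DCube d} (hI : I.set ⊆ Q.set)
    (hIΛ : ∫⁻ x in I.set, ‖g x‖ₑ ≤ 2 ^ d * Λ * volume I.set) :
    (∑' J, {J : DCube d | J.set ⊆ I.set ∧ J ∈ F ∧ N ≤ J.k}.indicator (haarEnergy g) J) +
      (Sfin d).card * meanEnergy g I ≤
      (Sfin d).card * (2 ^ d * Λ * ∫⁻ x in I.set, ‖g x‖ₑ) := by
  classical
  obtain ⟨r, hr⟩ : ∃ r : ℕ, I.k < N + r := ⟨(I.k - N).toNat + 1, by omega⟩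
  induction r generalizing I with
  | zero =>
    have : ∑' J, {J : DCube d | J.set ⊆ I.set ∧ J ∈ F ∧ N ≤ J.k}.indicator (haarEnergy g) J
        = 0 := by
      refine ENNReal.tsum_eq_zero.2 fun J => Set.indicator_of_notMem ?_ _
      rintro ⟨h1, -, h3⟩
      have := DCube.k_le_of_subset hd h1
      simp at hr
      omega
    rw [this, zero_add]
    gcongr
    exact meanEnergy_le hIΛ
  | succ r ih =>
    by_cases hIF : I ∈ F
    · have hchild : ∀ η, (∑' J, {J : DCube d | J.set ⊆ (I.child η).set ∧ J ∈ F ∧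
          N ≤ J.k}.indicator (haarEnergy g) J) + (Sfin d).card * meanEnergy g (I.child η) ≤
          (Sfin d).card * (2 ^ d * Λ * ∫⁻ x in (I.child η).set, ‖g x‖ₑ) := by
        intro η
        refine ih ((I.child_subset η).trans hI) ?_ ?_
        · calc ∫⁻ x in (I.child η).set, ‖g x‖ₑ ≤ ∫⁻ x in I.set, ‖g x‖ₑ :=
                lintegral_mono_set (I.child_subset η)
            _ ≤ Λ * volume I.set := hF I hIF hI
            _ = _ := by rw [← I.volume_child η]; ring
        · simp only [DCube.child]; push_cast at hr; omega
      have hsplit : ∀ J, {J : DCube d | J.set ⊆ I.set ∧ J ∈ F ∧ N ≤ J.k}.indicator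
          (haarEnergy g) J ≤ (if J = I then haarEnergy g I else 0) +
          ∑ η, {J : DCube d | J.set ⊆ (I.child η).set ∧ J ∈ F ∧ N ≤ J.k}.indicator
            (haarEnergy g) J := by
        intro J
        by_cases hJ : J ∈ {J : DCube d | J.set ⊆ I.set ∧ J ∈ F ∧ N ≤ J.k}
        swap
        · rw [Set.indicator_of_notMem hJ]
          exact zero_le
        rw [Set.indicator_of_mem hJ]
        obtain ⟨h1, h2, h3⟩ := hJ
        by_cases hJI : J = I
        · rw [if_pos hJI, hJI]; exact le_self_add
        · obtain ⟨η, hη⟩ := DCube.exists_subset_child hd h1 hJI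
          refine le_trans ?_ (le_add_self)
          refine le_trans ?_ (Finset.single_le_sum (fun _ _ => zero_le) (Finset.mem_univ η))
          rw [Set.indicator_of_mem]
          exact ⟨hη, h2, h3⟩
      have hle : ∑' J, {J : DCube d | J.set ⊆ I.set ∧ J ∈ F ∧ N ≤ J.k}.indicator
          (haarEnergy g) J ≤ haarEnergy g I + ∑ η, ∑' J, {J : DCube d |
            J.set ⊆ (I.child η).set ∧ J ∈ F ∧ N ≤ J.k}.indicator (haarEnergy g) J := by
        refine (ENNReal.tsum_le_tsum hsplit).trans ?_
        rw [ENNReal.tsum_add, tsum_ite_eq,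
          Summable.tsum_finsetSum fun _ _ => ENNReal.summable]
      have hint : ∫⁻ x in I.set, ‖g x‖ₑ = ∑ η, ∫⁻ x in (I.child η).set, ‖g x‖ₑ := by
        conv_lhs => rw [← I.iUnion_child]
        rw [lintegral_iUnion (fun η => (I.child η).measurableSet_set) I.pairwise_disjoint_child,
          tsum_fintype]
      calc _ ≤ (haarEnergy g I + ∑ η, ∑' J, {J : DCube d |
            J.set ⊆ (I.child η).set ∧ J ∈ F ∧ N ≤ J.k}.indicator (haarEnergy g) J) +
            (Sfin d).card * meanEnergy g I := by gcongr
        _ = (haarEnergy g I + (Sfin d).card * meanEnergy g I) + ∑ η, ∑' J, {J : DCube d |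
            J.set ⊆ (I.child η).set ∧ J ∈ F ∧ N ≤ J.k}.indicator (haarEnergy g) J := by ring
        _ ≤ (Sfin d).card * ∑ η, meanEnergy g (I.child η) + ∑ η, ∑' J, {J : DCube d |
            J.set ⊆ (I.child η).set ∧ J ∈ F ∧ N ≤ J.k}.indicator (haarEnergy g) J := by
            gcongr; exact haarEnergy_add_le (hg.mono_set hI)
        _ = ∑ η, ((∑' J, {J : DCube d | J.set ⊆ (I.child η).set ∧ J ∈ F ∧
          N ≤ J.k}.indicator (haarEnergy g) J) + (Sfin d).card * meanEnergy g (I.child η)) := by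
            rw [Finset.sum_add_distrib, Finset.mul_sum, add_comm]
        _ ≤ ∑ η, (Sfin d).card * (2 ^ d * Λ * ∫⁻ x in (I.child η).set, ‖g x‖ₑ) :=
            Finset.sum_le_sum fun η _ => hchild η
        _ = _ := by rw [hint, Finset.mul_sum, Finset.mul_sum]
    · have : ∑' J, {J : DCube d | J.set ⊆ I.set ∧ J ∈ F ∧ N ≤ J.k}.indicator (haarEnergy g) J
          = 0 := by
        refine ENNReal.tsum_eq_zero.2 fun J => Set.indicator_of_notMem ?_ _
        rintro ⟨h1, h2, -⟩
        exact hIF (hF' I J h2 h1 hI)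
      rw [this, zero_add]
      gcongr
      exact meanEnergy_le hIΛ

/-! ## An abstract sparse-type iteration -/

lemma ENNReal.tsum_rpow_mul_rpow_le {ι : Type*} {p p' : ℝ} (hpp : p'.HolderConjugate p)
    (x y : ι → ℝ≥0∞) :
    ∑' i, x i ^ (1 / p') * y i ^ (1 / p) ≤ (∑' i, x i) ^ (1 / p') * (∑' i, y i) ^ (1 / p) := by
  let _ : MeasurableSpace ι := ⊤
  have h := ENNReal.lintegral_mul_le_Lp_mul_Lq (Measure.count : Measure ι) hpp
    (f := fun i => x i ^ (1 / p')) (g := fun i => y i ^ (1 / p))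
    (measurable_from_top).aemeasurable (measurable_from_top).aemeasurable
  simp only [lintegral_count, Pi.mul_apply, ← ENNReal.rpow_mul, one_div,
    inv_mul_cancel₀ hpp.ne_zero, inv_mul_cancel₀ hpp.symm.ne_zero, ENNReal.rpow_one] at h
  simpa only [one_div] using h

lemma ENNReal.add_rpow_mul_rpow_le {p p' : ℝ} (hpp : p'.HolderConjugate p)
    (x y z w : ℝ≥0∞) :
    x ^ (1 / p') * y ^ (1 / p) + z ^ (1 / p') * w ^ (1 / p) ≤
      (x + z) ^ (1 / p') * (y + w) ^ (1 / p) := by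
  have h := ENNReal.tsum_rpow_mul_rpow_le hpp (ι := Bool) (fun b => if b then x else z)
    (fun b => if b then y else w)
  rw [tsum_fintype, tsum_fintype, tsum_fintype] at h
  simpa using h

lemma ENNReal.add_rpow_le_two_rpow_mul {q : ℝ} (hq : 0 ≤ q) (a b : ℝ≥0∞) :
    (a + b) ^ q ≤ 2 ^ q * (a ^ q + b ^ q) := by
  rcases le_total a b with h | h
  · calc (a + b) ^ q ≤ (2 * b) ^ q := by gcongr; rw [two_mul]; gcongr
      _ = 2 ^ q * b ^ q := ENNReal.mul_rpow_of_nonneg _ _ hq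
      _ ≤ _ := by gcongr; exact le_add_self
  · calc (a + b) ^ q ≤ (2 * a) ^ q := by gcongr; rw [two_mul]; gcongr
      _ = 2 ^ q * a ^ q := ENNReal.mul_rpow_of_nonneg _ _ hq
      _ ≤ _ := by gcongr; exact le_self_add

lemma setLIntegral_mul_le_Lp_mul_Lq {α : Type*} [MeasurableSpace α] {μ : Measure α} {p p' : ℝ}
    (hpp : p'.HolderConjugate p) {s h : α → ℝ≥0∞} (hs : Measurable s) (hh : Measurable h)
    (E : Set α) :
    ∫⁻ x in E, s x * h x ∂μ ≤
      (∫⁻ x in E, s x ^ p' ∂μ) ^ (1 / p') * (∫⁻ x in E, h x ^ p ∂μ) ^ (1 / p) :=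
  ENNReal.lintegral_mul_le_Lp_mul_Lq _ hpp hs.aemeasurable hh.aemeasurable

/-- The set of points of `Q` lying in none of the cubes of the family `ch`. -/
def stopRemainder {d : ℕ} (ch : Set (DCube d)) (Q : DCube d) : Set (Fin d → ℝ) :=
  Q.set \ ⋃ R : ch, (R : DCube d).set

lemma measurableSet_stopUnion {d : ℕ} (ch : Set (DCube d)) :
    MeasurableSet (⋃ R : ch, (R : DCube d).set) :=
  MeasurableSet.iUnion fun R => R.1.measurableSet_set

lemma measurableSet_stopRemainder {d : ℕ} (ch : Set (DCube d)) (Q : DCube d) :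
    MeasurableSet (stopRemainder ch Q) :=
  Q.measurableSet_set.diff (measurableSet_stopUnion ch)

lemma lintegral_stopRemainder_add {d : ℕ} {ch : Set (DCube d)} {Q : DCube d}
    (hsub : ∀ R ∈ ch, R.set ⊆ Q.set)
    (u : (Fin d → ℝ) → ℝ≥0∞) :
    ∫⁻ x in Q.set, u x = (∫⁻ x in stopRemainder ch Q, u x) +
      ∫⁻ x in ⋃ R : ch, (R : DCube d).set, u x := by
  rw [← lintegral_inter_add_sdiff u Q.set (measurableSet_stopUnion ch), add_comm,
    Set.inter_eq_right.2 (Set.iUnion_subset fun R : ch => hsub R.1 R.2)]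
  rfl

lemma lintegral_stopUnion {d : ℕ} {ch : Set (DCube d)}
    (hdisj : Pairwise (Function.onFun Disjoint fun R : ch => (R : DCube d).set))
    (u : (Fin d → ℝ) → ℝ≥0∞) :
    ∫⁻ x in ⋃ R : ch, (R : DCube d).set, u x = ∑' R : ch, ∫⁻ x in (R : DCube d).set, u x :=
  lintegral_iUnion (fun R : ch => R.1.measurableSet_set) hdisj u

/-- Iteration of a stopping-time decomposition in which the stopping cubes carry a fixed
proportion of Lebesgue measure and, for each of the weights `s i ^ p'`, at most a proportion
`η ^ p'` of its mass. -/
theorem lintegral_rpow_le_of_stopping {d : ℕ} {N : ℤ} {p p' q η : ℝ}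
    (hpp : p'.HolderConjugate p) (hq : 0 < q) (hη : 0 < η) (hη1 : η < 1) {ι : Type*}
    {s : ι → (Fin d → ℝ) → ℝ≥0∞} (hs : ∀ i, Measurable (s i))
    {h : (Fin d → ℝ) → ℝ≥0∞} (hh : Measurable h)
    {S : DCube d → (Fin d → ℝ) → ℝ≥0∞} {a : DCube d → ℝ≥0∞} {ch : DCube d → Set (DCube d)}
    {D : ℝ≥0∞}
    (hsub : ∀ Q, ∀ R ∈ ch Q, R.set ⊆ Q.set)
    (hk : ∀ Q, ∀ R ∈ ch Q, N ≤ R.k ∧ R.k < Q.k)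
    (hdisj : ∀ Q, Pairwise (Function.onFun Disjoint fun R : ch Q => (R : DCube d).set))
    (hvol : ∀ Q, 2 ^ (q + 1) * volume (⋃ R : ch Q, (R : DCube d).set) ≤ volume Q.set)
    (hσ : ∀ i Q, ∫⁻ x in ⋃ R : ch Q, (R : DCube d).set, s i x ^ p' ≤
      ENNReal.ofReal (η ^ p') * ∫⁻ x in Q.set, s i x ^ p')
    (hS : ∀ Q, ∀ x ∈ stopRemainder (ch Q) Q, S Q x ≤ a Q)
    (hS' : ∀ Q, ∀ R ∈ ch Q, ∀ x ∈ R.set, S Q x ≤ a Q + S R x)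
    (ha : ∀ Q : DCube d, N ≤ Q.k → ∀ H : ℝ≥0∞,
      (∀ i, ∫⁻ x in Q.set, s i x * h x ≤ ENNReal.ofReal (1 / (1 - η)) ^ (1 / p') *
        (∫⁻ x in Q.set, s i x ^ p') ^ (1 / p') * H ^ (1 / p)) →
      a Q ^ q * volume Q.set ≤ D * H)
    (Q : DCube d) (hQ : N ≤ Q.k) :
    ∫⁻ x in Q.set, S Q x ^ q ≤
      2 ^ (q + 1) * D * (ENNReal.ofReal (1 / (1 - η)) * ∫⁻ x in Q.set, h x ^ p) := by
  set τ := ENNReal.ofReal (1 / (1 - η)) with hτ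
  set e := ENNReal.ofReal η with he
  have hτη : 1 + e * τ = τ := by
    rw [hτ, he, ← ENNReal.ofReal_mul hη.le, ← ENNReal.ofReal_one,
      ← ENNReal.ofReal_add zero_le_one (by have := sub_pos.2 hη1; positivity)]
    congr 1
    have := (sub_pos.2 hη1).ne'
    field_simp
    ring
  have he0 : e ≠ 0 := by simpa [he] using hη
  have het : e ≠ ⊤ := ENNReal.ofReal_ne_top
  suffices key : ∀ r : ℕ, ∀ Q : DCube d, Q.k = N + r → ∃ H X : ℝ≥0∞,
      (∀ A : ℝ≥0∞, ∫⁻ x in Q.set, (A + S Q x) ^ q ≤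
        2 ^ (q + 1) * A ^ q * volume Q.set + 2 ^ (q + 1) * D * X) ∧
      (∀ i, ∫⁻ x in Q.set, s i x * h x ≤ τ ^ (1 / p') *
        (∫⁻ x in Q.set, s i x ^ p') ^ (1 / p') * H ^ (1 / p)) ∧
      X + e * τ * H ≤ τ * ∫⁻ x in Q.set, h x ^ p by
    obtain ⟨r, hr⟩ := Int.eq_ofNat_of_zero_le (sub_nonneg.2 hQ)
    obtain ⟨H, X, h1, -, h3⟩ := key r Q (by omega)
    have := h1 0
    simp only [zero_add, ENNReal.zero_rpow_of_pos hq, mul_zero, zero_mul] at this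
    refine this.trans ?_
    gcongr
    exact le_self_add.trans h3
  intro r
  induction r using Nat.strong_induction_on with
  | _ r ih =>
  intro Q hQr
  have ih' : ∀ R : ch Q, ∃ H X : ℝ≥0∞,
      (∀ A : ℝ≥0∞, ∫⁻ x in R.1.set, (A + S R x) ^ q ≤
        2 ^ (q + 1) * A ^ q * volume R.1.set + 2 ^ (q + 1) * D * X) ∧
      (∀ i, ∫⁻ x in R.1.set, s i x * h x ≤ τ ^ (1 / p') *
        (∫⁻ x in R.1.set, s i x ^ p') ^ (1 / p') * H ^ (1 / p)) ∧
      X + e * τ * H ≤ τ * ∫⁻ x in R.1.set, h x ^ p := by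
    rintro ⟨R, hR⟩
    obtain ⟨h1, h2⟩ := hk Q R hR
    obtain ⟨r', hr'⟩ := Int.eq_ofNat_of_zero_le (sub_nonneg.2 h1)
    exact ih r' (by omega) R (by omega)
  choose H X h1 h2 h3 using ih'
  set E := stopRemainder (ch Q) Q with hE
  set HE := ∫⁻ x in E, h x ^ p
  set HQ := HE + ∑' R, e * H R with hHQ
  have hp0 := hpp.symm.pos
  have hp'0 := hpp.pos
  have hsplit := fun u => lintegral_stopRemainder_add (hsub Q) u
  have hunion := fun u => lintegral_stopUnion (hdisj Q) u
  have claim2 : ∀ i, ∫⁻ x in Q.set, s i x * h x ≤ τ ^ (1 / p') *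
        (∫⁻ x in Q.set, s i x ^ p') ^ (1 / p') * HQ ^ (1 / p) := by
    intro i
    set t : ℝ≥0∞ := e ^ (-(p' / p)) with ht
    have hte : t ^ (1 / p') * e ^ (1 / p) = 1 := by
      rw [ht, ← ENNReal.rpow_mul, ← ENNReal.rpow_add _ _ he0 het]
      convert ENNReal.rpow_zero using 2
      field_simp
      ring
    have hR : ∀ R : ch Q, ∫⁻ x in R.1.set, s i x * h x ≤
        (t * τ * ∫⁻ x in R.1.set, s i x ^ p') ^ (1 / p') * (e * H R) ^ (1 / p) := by
      intro R
      refine (h2 R i).trans_eq ?_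
      rw [ENNReal.mul_rpow_of_nonneg _ _ (by positivity : 0 ≤ 1 / p'),
        ENNReal.mul_rpow_of_nonneg _ _ (by positivity : 0 ≤ 1 / p'),
        ENNReal.mul_rpow_of_nonneg _ _ (by positivity : 0 ≤ 1 / p)]
      calc _ = (t ^ (1 / p') * e ^ (1 / p)) * (τ ^ (1 / p') *
            (∫⁻ x in R.1.set, s i x ^ p') ^ (1 / p') * H R ^ (1 / p)) := by rw [hte, one_mul]
        _ = _ := by ring
    have htot : (∫⁻ x in E, s i x ^ p') + ∑' R : ch Q, t * τ * ∫⁻ x in R.1.set, s i x ^ p' ≤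
        τ * ∫⁻ x in Q.set, s i x ^ p' := by
      rw [ENNReal.tsum_mul_left, ← hunion]
      calc _ ≤ (∫⁻ x in Q.set, s i x ^ p') +
            t * τ * (ENNReal.ofReal (η ^ p') * ∫⁻ x in Q.set, s i x ^ p') := by
            gcongr
            · exact Set.sdiff_subset
            · exact hσ i Q
        _ = (1 + (t * ENNReal.ofReal (η ^ p')) * τ) * ∫⁻ x in Q.set, s i x ^ p' := by ring
        _ = _ := by
            have : t * ENNReal.ofReal (η ^ p') = e := by
              rw [← ENNReal.ofReal_rpow_of_pos hη, ht, ← ENNReal.rpow_add _ _ he0 het]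
              convert ENNReal.rpow_one e using 2
              have := hpp.inv_add_inv_eq_one
              field_simp at this ⊢
              linarith
            rw [this, hτη]
    calc ∫⁻ x in Q.set, s i x * h x
        = (∫⁻ x in E, s i x * h x) + ∑' R : ch Q, ∫⁻ x in R.1.set, s i x * h x := by
          rw [hsplit, hunion]
      _ ≤ (∫⁻ x in E, s i x ^ p') ^ (1 / p') * HE ^ (1 / p) + ∑' R : ch Q,
          (t * τ * ∫⁻ x in R.1.set, s i x ^ p') ^ (1 / p') * (e * H R) ^ (1 / p) :=
          add_le_add (setLIntegral_mul_le_Lp_mul_Lq hpp (hs i) hh E)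
            (ENNReal.tsum_le_tsum hR)
      _ ≤ (∫⁻ x in E, s i x ^ p') ^ (1 / p') * HE ^ (1 / p) +
          (∑' R : ch Q, t * τ * ∫⁻ x in R.1.set, s i x ^ p') ^ (1 / p') *
            (∑' R, e * H R) ^ (1 / p) := by
          gcongr
          exact ENNReal.tsum_rpow_mul_rpow_le hpp _ _
      _ ≤ _ := ENNReal.add_rpow_mul_rpow_le hpp _ _ _ _
      _ ≤ (τ * ∫⁻ x in Q.set, s i x ^ p') ^ (1 / p') * HQ ^ (1 / p) := by gcongr
      _ = _ := by rw [ENNReal.mul_rpow_of_nonneg _ _ (by positivity : 0 ≤ 1 / p')]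
  refine ⟨HQ, HQ + ∑' R, X R, fun A => ?_, claim2, ?_⟩
  · have haQ := ha Q (by omega) HQ claim2
    calc ∫⁻ x in Q.set, (A + S Q x) ^ q
        = (∫⁻ x in E, (A + S Q x) ^ q) + ∑' R : ch Q, ∫⁻ x in R.1.set, (A + S Q x) ^ q := by
          rw [hsplit, hunion]
      _ ≤ (∫⁻ x in Q.set, (A + a Q) ^ q) + ∑' R : ch Q,
          (2 ^ (q + 1) * (A + a Q) ^ q * volume R.1.set + 2 ^ (q + 1) * D * X R) := by
          refine add_le_add ?_ (ENNReal.tsum_le_tsum fun R => ?_)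
          · refine (setLIntegral_mono' (measurableSet_stopRemainder _ _)
              (g := fun _ => (A + a Q) ^ q) fun x hx => ?_).trans
              (lintegral_mono_set Set.sdiff_subset)
            gcongr
            exact hS Q x hx
          · refine (setLIntegral_mono' R.1.measurableSet_set fun x hx => ?_).trans
              (h1 R (A + a Q))
            refine ENNReal.rpow_le_rpow ?_ hq.le
            rw [add_assoc]
            gcongr
            exact hS' Q R R.2 x hx
      _ = (A + a Q) ^ q * volume Q.set + (A + a Q) ^ q *
          (2 ^ (q + 1) * volume (⋃ R : ch Q, R.1.set)) + 2 ^ (q + 1) * D * ∑' R, X R := by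
          rw [setLIntegral_const, ENNReal.tsum_add, ENNReal.tsum_mul_left, ENNReal.tsum_mul_left,
            measure_iUnion (hdisj Q) fun R => R.1.measurableSet_set]
          ring
      _ ≤ (A + a Q) ^ q * volume Q.set + (A + a Q) ^ q * volume Q.set +
          2 ^ (q + 1) * D * ∑' R, X R := by
          gcongr
          exact hvol Q
      _ = 2 * (A + a Q) ^ q * volume Q.set + 2 ^ (q + 1) * D * ∑' R, X R := by ring
      _ ≤ 2 * (2 ^ q * (A ^ q + a Q ^ q)) * volume Q.set + 2 ^ (q + 1) * D * ∑' R, X R := by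
          gcongr
          exact ENNReal.add_rpow_le_two_rpow_mul hq.le _ _
      _ = 2 ^ (q + 1) * A ^ q * volume Q.set + 2 ^ (q + 1) * (a Q ^ q * volume Q.set) +
          2 ^ (q + 1) * D * ∑' R, X R := by
          rw [ENNReal.rpow_add _ _ two_ne_zero ofNat_ne_top, ENNReal.rpow_one]
          ring
      _ ≤ 2 ^ (q + 1) * A ^ q * volume Q.set + 2 ^ (q + 1) * (D * HQ) +
          2 ^ (q + 1) * D * ∑' R, X R := by gcongr
      _ = _ := by ring
  · calc HQ + ∑' R, X R + e * τ * HQ = (1 + e * τ) * HQ + ∑' R, X R := by ring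
      _ = τ * HE + ∑' R, (X R + e * τ * H R) := by
          rw [hτη, hHQ, ENNReal.tsum_add, ENNReal.tsum_mul_left, ENNReal.tsum_mul_left]
          ring
      _ ≤ τ * HE + ∑' R : ch Q, τ * ∫⁻ x in R.1.set, h x ^ p := by
          gcongr with R
          exact h3 R
      _ = _ := by rw [ENNReal.tsum_mul_left, ← hunion, ← mul_add, ← hsplit]

/-! ## Consequences of the matrix `A_p` condition -/

/-- The inner average `|Q|⁻¹ ∫_Q ‖W^{1/p}(x) W^{-1/p}(t)‖^{p'} dt` of the `A_p` condition. -/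
def apInner {d n : ℕ} (p : ℝ) (W : (Fin d → ℝ) → Matrix (Fin n) (Fin n) ℂ) (Q : DCube d)
    (x : Fin d → ℝ) : ℝ≥0∞ :=
  (volume Q.set)⁻¹ * ∫⁻ t in Q.set, ENNReal.ofReal (matNorm (W x * (W t)⁻¹)) ^ (p / (p - 1))

/-- The scalar function `t ↦ ‖W^{-1/p}(t) M‖`. -/
def invNorm {d n : ℕ} (W : (Fin d → ℝ) → Matrix (Fin n) (Fin n) ℂ)
    (M : Matrix (Fin n) (Fin n) ℂ) (t : Fin d → ℝ) : ℝ≥0∞ :=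
  ENNReal.ofReal (matNorm ((W t)⁻¹ * M))

section Weight

variable {d n : ℕ} {p : ℝ} {W : (Fin d → ℝ) → Matrix (Fin n) (Fin n) ℂ}

lemma measurable_invNorm (hW : MatMeasurable W) (M : Matrix (Fin n) (Fin n) ℂ) :
    Measurable (invNorm W M) :=
  ENNReal.measurable_ofReal.comp (measurable_matNorm_comp
    (measurable_mul_entry (measurable_inv_entry hW) fun _ _ => measurable_const))

lemma measurable_apInner (hW : MatMeasurable W) (Q : DCube d) : Measurable (apInner p W Q) := by
  refine Measurable.const_mul ?_ _
  refine Measurable.lintegral_prod_right' (f := fun z : (Fin d → ℝ) × (Fin d → ℝ) =>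
    ENNReal.ofReal (matNorm (W z.1 * (W z.2)⁻¹)) ^ (p / (p - 1))) ?_
  refine Measurable.pow_const (ENNReal.measurable_ofReal.comp (measurable_matNorm_comp
    (measurable_mul_entry (fun i j => (hW i j).comp measurable_fst) fun i j => ?_))) _
  exact (measurable_inv_entry hW i j).comp measurable_snd

lemma lintegral_apInner_rpow_le (hp : 1 < p) (Q : DCube d) :
    ∫⁻ x in Q.set, apInner p W Q x ^ (p - 1) ≤ apNorm p W * volume Q.set := by
  have hsub : Q.set ⊆ cubeSet Q.corner Q.side := by
    intro x hx i
    have := hx i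
    simp only [DCube.corner, DCube.side]
    exact ⟨this.1, by linarith [this.2]⟩
  have hv : ENNReal.ofReal (Q.side ^ d) = volume Q.set := by
    rw [DCube.volume_set]; rfl
  have h := le_iSup₂_of_le (f := fun (c : Fin d → ℝ) (r : ℝ) => ⨆ (_ : 0 < r),
    (ENNReal.ofReal (r ^ d))⁻¹ *
      ∫⁻ x in cubeSet c r,
        ((ENNReal.ofReal (r ^ d))⁻¹ *
            ∫⁻ t in cubeSet c r,
              ENNReal.ofReal (matNorm (W x * (W t)⁻¹)) ^ (p / (p - 1))) ^ (p - 1))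
    Q.corner Q.side
    (le_iSup_of_le (by unfold DCube.side; positivity : (0 : ℝ) < Q.side) le_rfl)
  rw [hv] at h
  rw [mul_comm, ← ENNReal.inv_mul_le_iff Q.volume_set_ne_zero Q.volume_set_ne_top]
  refine le_trans ?_ h
  refine mul_le_mul' le_rfl ?_
  refine (lintegral_mono fun x => ?_).trans (lintegral_mono_set hsub)
  refine ENNReal.rpow_le_rpow ?_ (by linarith)
  unfold apInner
  gcongr

lemma invNorm_rpow_lintegral_le (hp : 1 < p)
    (hpos : ∀ᵐ x ∂(volume : Measure (Fin d → ℝ)), (W x).PosDef) (Q : DCube d)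
    (M : Matrix (Fin n) (Fin n) ℂ) {x : Fin d → ℝ} (hx : (W x).PosDef) :
    ∫⁻ t in Q.set, invNorm W M t ^ (p / (p - 1)) ≤
      volume Q.set * apInner p W Q x * invNorm W M x ^ (p / (p - 1)) := by
  have hp' : 0 ≤ p / (p - 1) := div_nonneg (by linarith) (by linarith)
  unfold apInner
  rw [← mul_assoc, ENNReal.mul_inv_cancel Q.volume_set_ne_zero Q.volume_set_ne_top, one_mul]
  rw [← lintegral_mul_const' (invNorm W M x ^ (p / (p - 1))) _
    (ENNReal.rpow_ne_top_of_nonneg hp' ENNReal.ofReal_ne_top)]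
  refine lintegral_mono_ae (ae_restrict_of_ae ?_)
  filter_upwards [hpos] with t ht
  rw [← ENNReal.mul_rpow_of_nonneg _ _ hp']
  refine ENNReal.rpow_le_rpow ?_ hp'
  unfold invNorm
  rw [← ENNReal.ofReal_mul (matNorm_nonneg _)]
  refine ENNReal.ofReal_le_ofReal ?_
  rw [matNorm_mul_comm_of_isHermitian hx.isHermitian ht.isHermitian.inv]
  calc matNorm ((W t)⁻¹ * M) = matNorm (((W t)⁻¹ * W x) * ((W x)⁻¹ * M)) := by
        rw [Matrix.mul_assoc, ← Matrix.mul_assoc (W x), hx.mul_inv_self, Matrix.one_mul]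
    _ ≤ _ := matNorm_mul_le _ _

lemma DCube.exists_mem_of_ae {d : ℕ} (Q : DCube d) {P : (Fin d → ℝ) → Prop}
    (h : ∀ᵐ x ∂(volume.restrict Q.set), P x) : ∃ x ∈ Q.set, P x := by
  have : (volume.restrict Q.set) ≠ 0 := by
    rw [Ne, Measure.restrict_eq_zero]; exact Q.volume_set_ne_zero
  have : (ae (volume.restrict Q.set)).NeBot := ae_neBot.2 this
  obtain ⟨x, hx, hx'⟩ := (h.and (ae_restrict_mem Q.measurableSet_set)).exists
  exact ⟨x, hx', hx⟩

lemma matNorm_ne_zero_of_isUnit (hn : 0 < n) {A B : Matrix (Fin n) (Fin n) ℂ} (h : A * B = 1) :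
    matNorm A ≠ 0 := by
  intro h0
  have : Nonempty (Fin n) := ⟨⟨0, hn⟩⟩
  rw [matNorm_eq_zero h0, Matrix.zero_mul] at h
  exact zero_ne_one h

lemma apNorm_ne_zero (hn : 0 < n) (hp : 1 < p) (hW : MatMeasurable W)
    (hpos : ∀ᵐ x ∂(volume : Measure (Fin d → ℝ)), (W x).PosDef) (Q : DCube d) :
    apNorm p W ≠ 0 := by
  intro h0
  have hp' : 0 < p / (p - 1) := div_pos (by linarith) (by linarith)
  have h := lintegral_apInner_rpow_le (W := W) hp Q
  rw [h0, zero_mul, nonpos_iff_eq_zero, lintegral_eq_zero_iff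
    ((measurable_apInner hW Q).pow_const _)] at h
  obtain ⟨x, -, hx, hx0⟩ := Q.exists_mem_of_ae ((ae_restrict_of_ae hpos).and h)
  have hx0 : apInner p W Q x = 0 := (ENNReal.rpow_eq_zero_iff_of_pos (sub_pos.2 hp)).1 hx0
  have hm : Measurable fun t => ENNReal.ofReal (matNorm (W x * (W t)⁻¹)) ^ (p / (p - 1)) :=
    Measurable.pow_const (ENNReal.measurable_ofReal.comp (measurable_matNorm_comp
      (measurable_mul_entry (F := fun _ => W x) (fun _ _ => measurable_const)
        (measurable_inv_entry hW)))) _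
  have hx0 := (mul_eq_zero.1 hx0).resolve_left (ENNReal.inv_ne_zero.2 Q.volume_set_ne_top)
  rw [lintegral_eq_zero_iff hm] at hx0
  obtain ⟨t, -, ht, ht0⟩ := Q.exists_mem_of_ae ((ae_restrict_of_ae hpos).and hx0)
  have ht0 : ENNReal.ofReal (matNorm (W x * (W t)⁻¹)) = 0 :=
    (ENNReal.rpow_eq_zero_iff_of_pos hp').1 ht0
  refine matNorm_ne_zero_of_isUnit hn (A := W x * (W t)⁻¹) (B := W t * (W x)⁻¹) ?_
    (le_antisymm (ENNReal.ofReal_eq_zero.1 ht0) (matNorm_nonneg _))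
  rw [Matrix.mul_assoc, ← Matrix.mul_assoc _ (W t), ht.inv_mul_self, Matrix.one_mul,
    hx.mul_inv_self]

lemma ae_apInner_lt_top (hp : 1 < p) (hW : MatMeasurable W) (hap : apNorm p W < ⊤)
    (Q : DCube d) : ∀ᵐ x ∂(volume.restrict Q.set), apInner p W Q x < ⊤ := by
  have h := ae_lt_top ((measurable_apInner (p := p) hW Q).pow_const (p - 1))
    (μ := volume.restrict Q.set)
    ((lintegral_apInner_rpow_le hp Q).trans_lt
      (ENNReal.mul_lt_top hap Q.volume_set_ne_top.lt_top)).ne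
  filter_upwards [h] with x hx
  by_contra hx'
  rw [not_lt_top_iff.1 hx', ENNReal.top_rpow_of_pos (by linarith)] at hx
  exact lt_irrefl _ hx

lemma invNorm_rpow_lintegral_ne_top (hp : 1 < p) (hW : MatMeasurable W)
    (hpos : ∀ᵐ x ∂(volume : Measure (Fin d → ℝ)), (W x).PosDef) (hap : apNorm p W < ⊤)
    (Q : DCube d) (M : Matrix (Fin n) (Fin n) ℂ) :
    ∫⁻ t in Q.set, invNorm W M t ^ (p / (p - 1)) ≠ ⊤ := by
  obtain ⟨x, -, hx, hx'⟩ :=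
    Q.exists_mem_of_ae ((ae_restrict_of_ae hpos).and (ae_apInner_lt_top hp hW hap Q))
  refine ((invNorm_rpow_lintegral_le hp hpos Q M hx).trans_lt ?_).ne
  exact ENNReal.mul_lt_top (ENNReal.mul_lt_top Q.volume_set_ne_top.lt_top hx')
    (ENNReal.rpow_lt_top_of_nonneg (div_nonneg (by linarith) (by linarith))
      ENNReal.ofReal_ne_top)

/-- The constant of the `A_∞`-type comparison `invNorm_rpow_lintegral_le_of_half`. -/
def ainfConst {d n : ℕ} (p : ℝ) (W : (Fin d → ℝ) → Matrix (Fin n) (Fin n) ℂ) : ℝ≥0∞ :=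
  4 * (4 * apNorm p W) ^ (1 / (p - 1))

lemma invNorm_rpow_lintegral_le_of_half (hn : 0 < n) (hp : 1 < p) (hW : MatMeasurable W)
    (hpos : ∀ᵐ x ∂(volume : Measure (Fin d → ℝ)), (W x).PosDef) (hap : apNorm p W < ⊤)
    (Q : DCube d) (M : Matrix (Fin n) (Fin n) ℂ) {E : Set (Fin d → ℝ)} (hE : MeasurableSet E)
    (hEQ : E ⊆ Q.set) (hvol : volume Q.set ≤ 2 * volume E) :
    ∫⁻ t in Q.set, invNorm W M t ^ (p / (p - 1)) ≤
      ainfConst p W * ∫⁻ t in E, invNorm W M t ^ (p / (p - 1)) := by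
  have hap0 := apNorm_ne_zero hn hp hW hpos Q
  have hm := (measurable_apInner (p := p) hW Q).pow_const (p - 1)
  set B := {x | 4 * apNorm p W ≤ apInner p W Q x ^ (p - 1)} with hB
  have hBm : MeasurableSet B := measurableSet_le measurable_const hm
  have hBvol : 4 * volume (E ∩ B) ≤ volume Q.set := by
    have h := mul_meas_ge_le_lintegral (μ := volume.restrict Q.set) hm (4 * apNorm p W)
    have h := h.trans (lintegral_apInner_rpow_le hp Q)
    rw [Measure.restrict_apply hBm, mul_comm 4, mul_assoc] at h
    have h := (ENNReal.mul_le_mul_iff_right hap0 hap.ne).1 h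
    refine le_trans ?_ h
    exact mul_le_mul' le_rfl (measure_mono fun x hx => ⟨hx.2, hEQ hx.1⟩)
  have hG : volume Q.set ≤ 4 * volume (E \ B) := by
    have h1 : volume E = volume (E ∩ B) + volume (E \ B) := (measure_inter_add_sdiff E hBm).symm
    rw [h1] at hvol
    have : volume Q.set + volume Q.set ≤ volume Q.set + 4 * volume (E \ B) := by
      calc volume Q.set + volume Q.set ≤ 2 * (volume (E ∩ B) + volume (E \ B)) +
            2 * (volume (E ∩ B) + volume (E \ B)) := by gcongr
        _ = 4 * volume (E ∩ B) + 4 * volume (E \ B) := by ring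
        _ ≤ _ := by gcongr
    exact (ENNReal.add_le_add_iff_left Q.volume_set_ne_top).1 this
  set σ := ∫⁻ t in Q.set, invNorm W M t ^ (p / (p - 1)) with hσ
  have hpt : volume (E \ B) * σ ≤ volume Q.set * (4 * apNorm p W) ^ (1 / (p - 1)) *
      ∫⁻ t in E, invNorm W M t ^ (p / (p - 1)) := by
    calc volume (E \ B) * σ = ∫⁻ x in E \ B, σ := by rw [setLIntegral_const, mul_comm]
      _ ≤ ∫⁻ x in E \ B, volume Q.set * (4 * apNorm p W) ^ (1 / (p - 1)) *
          invNorm W M x ^ (p / (p - 1)) := by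
          refine lintegral_mono_ae ?_
          filter_upwards [ae_restrict_of_ae hpos, ae_restrict_mem (hE.diff hBm)] with x hx hxE
          refine (invNorm_rpow_lintegral_le hp hpos Q M hx).trans ?_
          gcongr
          have : apInner p W Q x ^ (p - 1) ≤ 4 * apNorm p W := (not_le.1 hxE.2).le
          calc apInner p W Q x = (apInner p W Q x ^ (p - 1)) ^ (1 / (p - 1)) := by
                rw [← ENNReal.rpow_mul, mul_one_div_cancel (by linarith), ENNReal.rpow_one]
            _ ≤ _ := ENNReal.rpow_le_rpow this (one_div_nonneg.2 (by linarith))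
      _ ≤ ∫⁻ x in E, volume Q.set * (4 * apNorm p W) ^ (1 / (p - 1)) *
          invNorm W M x ^ (p / (p - 1)) := lintegral_mono_set Set.sdiff_subset
      _ = _ := lintegral_const_mul _ ((measurable_invNorm hW M).pow_const _)
  refine (ENNReal.mul_le_mul_iff_right Q.volume_set_ne_zero Q.volume_set_ne_top).1 ?_
  calc volume Q.set * σ ≤ 4 * volume (E \ B) * σ := by gcongr
    _ = 4 * (volume (E \ B) * σ) := by ring
    _ ≤ 4 * (volume Q.set * (4 * apNorm p W) ^ (1 / (p - 1)) *
      ∫⁻ t in E, invNorm W M t ^ (p / (p - 1))) := by gcongr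
    _ = _ := by unfold ainfConst; ring

lemma one_le_ainfConst (hn : 0 < n) (hp : 1 < p) (hW : MatMeasurable W)
    (hpos : ∀ᵐ x ∂(volume : Measure (Fin d → ℝ)), (W x).PosDef) (hap : apNorm p W < ⊤)
    (Q : DCube d) : 1 ≤ ainfConst p W := by
  have hp' : 0 < p / (p - 1) := div_pos (by linarith) (by linarith)
  have h := invNorm_rpow_lintegral_le_of_half hn hp hW hpos hap Q 1 Q.measurableSet_set
    subset_rfl (by rw [two_mul]; exact le_self_add)
  have ht := invNorm_rpow_lintegral_ne_top hp hW hpos hap Q 1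
  have h0 : ∫⁻ t in Q.set, invNorm W 1 t ^ (p / (p - 1)) ≠ 0 := by
    intro h0
    rw [lintegral_eq_zero_iff ((measurable_invNorm hW 1).pow_const _)] at h0
    obtain ⟨t, -, ht, ht0⟩ := Q.exists_mem_of_ae ((ae_restrict_of_ae hpos).and h0)
    have ht0 : invNorm W 1 t = 0 := (ENNReal.rpow_eq_zero_iff_of_pos hp').1 ht0
    unfold invNorm at ht0
    rw [Matrix.mul_one] at ht0
    exact matNorm_ne_zero_of_isUnit hn ht.inv_mul_self
      (le_antisymm (ENNReal.ofReal_eq_zero.1 ht0) (matNorm_nonneg _))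
  have := (ENNReal.mul_le_mul_iff_left h0 ht).1 ((one_mul _).trans_le h)
  exact this

/-- The mass of a small subset is a proper proportion of the total mass. -/
lemma invNorm_rpow_lintegral_le_of_small (hn : 0 < n) (hp : 1 < p) (hW : MatMeasurable W)
    (hpos : ∀ᵐ x ∂(volume : Measure (Fin d → ℝ)), (W x).PosDef) (hap : apNorm p W < ⊤)
    (Q : DCube d) (M : Matrix (Fin n) (Fin n) ℂ) {U : Set (Fin d → ℝ)} (hU : MeasurableSet U)
    (hUQ : U ⊆ Q.set) (hvol : 2 * volume U ≤ volume Q.set) :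
    ∫⁻ t in U, invNorm W M t ^ (p / (p - 1)) ≤
      (1 - (ainfConst p W)⁻¹) * ∫⁻ t in Q.set, invNorm W M t ^ (p / (p - 1)) := by
  have hUt : volume U ≠ ⊤ := measure_ne_top_of_subset hUQ Q.volume_set_ne_top
  have hE : volume Q.set ≤ 2 * volume (Q.set \ U) := by
    rw [measure_sdiff hUQ hU.nullMeasurableSet hUt, ENNReal.mul_sub (by simp)]
    refine ENNReal.le_sub_of_add_le_left (by finiteness) ?_
    rw [two_mul (volume Q.set)]
    gcongr
  have h := invNorm_rpow_lintegral_le_of_half hn hp hW hpos hap Q M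
    (Q.measurableSet_set.diff hU) Set.sdiff_subset hE
  have hB := one_le_ainfConst hn hp hW hpos hap Q
  have hBt : ainfConst p W ≠ ⊤ := by
    unfold ainfConst
    exact ENNReal.mul_ne_top (by simp) (ENNReal.rpow_ne_top_of_nonneg
      (one_div_nonneg.2 (by linarith)) (ENNReal.mul_ne_top (by simp) hap.ne))
  have ht := invNorm_rpow_lintegral_ne_top hp hW hpos hap Q M
  have hsplit := lintegral_inter_add_sdiff (μ := volume)
    (fun t => invNorm W M t ^ (p / (p - 1))) Q.set hU
  rw [Set.inter_eq_right.2 hUQ] at hsplit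
  rw [ENNReal.sub_mul (fun _ _ => ht), one_mul]
  refine ENNReal.le_sub_of_add_le_right
    (ENNReal.mul_ne_top (ENNReal.inv_ne_top.2 (one_pos.trans_le hB).ne') ht) ?_
  rw [← hsplit]
  gcongr
  rw [hsplit, ENNReal.inv_mul_le_iff (one_pos.trans_le hB).ne' hBt]
  exact h

end Weight

/-! ## Reducing operators -/

/-- Hahn–Banach for seminorms on `ℂⁿ`, in terms of the real part of the inner product. -/
lemma exists_re_inner_le {n : ℕ} (ρ : EuclideanSpace ℂ (Fin n) → ℝ) (hρ0 : ∀ x, 0 ≤ ρ x)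
    (hρ : ∀ c : ℝ, 0 < c → ∀ x, ρ (c • x) = c * ρ x) (hadd : ∀ x y, ρ (x + y) ≤ ρ x + ρ y)
    (u : EuclideanSpace ℂ (Fin n)) :
    ∃ e : EuclideanSpace ℂ (Fin n),
      (∀ x, RCLike.re (inner ℂ e x) ≤ ρ x) ∧ RCLike.re (inner ℂ e u) = ρ u := by
  let _ : InnerProductSpace ℝ (EuclideanSpace ℂ (Fin n)) :=
    InnerProductSpace.rclikeToReal ℂ (EuclideanSpace ℂ (Fin n))
  have h0 : ρ 0 = 0 := by
    have := hρ 2 two_pos 0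
    rw [smul_zero] at this
    linarith
  by_cases hu : u = 0
  · exact ⟨0, fun x => by simpa using hρ0 x, by simp [hu, h0]⟩
  obtain ⟨g, hg, hg'⟩ := exists_extension_of_le_sublinear
    (LinearPMap.mkSpanSingleton (σ := RingHom.id ℝ) u (ρ u) hu) ρ hρ hadd (by
      rintro ⟨x, hx⟩
      obtain ⟨c, rfl⟩ := Submodule.mem_span_singleton.1 hx
      rw [LinearPMap.mkSpanSingleton'_apply]
      simp only [RingHom.id_apply, smul_eq_mul]
      rcases lt_or_ge 0 c with hc | hc
      · exact (hρ c hc u).ge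
      · exact (mul_nonpos_of_nonpos_of_nonneg hc (hρ0 u)).trans (hρ0 _))
  refine ⟨(InnerProductSpace.toDual ℝ _).symm (LinearMap.toContinuousLinearMap g), ?_, ?_⟩
  · intro x
    rw [← real_inner_eq_re_inner ℂ, InnerProductSpace.toDual_symm_apply]
    exact hg' x
  · rw [← real_inner_eq_re_inner ℂ, InnerProductSpace.toDual_symm_apply]
    exact (hg ⟨u, Submodule.mem_span_singleton_self u⟩).trans
      (LinearPMap.mkSpanSingleton_apply ℝ ℝ hu (ρ u))

section Weight

variable {d n : ℕ} {p c₁ c₂ : ℝ} {W : (Fin d → ℝ) → Matrix (Fin n) (Fin n) ℂ}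
  {V : DCube d → Matrix (Fin n) (Fin n) ℂ}

lemma IsReducing.lintegral_rpow_le (hV : IsReducing p c₁ c₂ W V) (hp : 1 < p) (hc₁ : 0 < c₁)
    (Q : DCube d) (e : EuclideanSpace ℂ (Fin n)) :
    ∫⁻ x in Q.set, ENNReal.ofReal ‖mApp (W x) e‖ ^ p ≤
      (ENNReal.ofReal c₁)⁻¹ ^ p * ENNReal.ofReal ‖mApp (V Q) e‖ ^ p * volume Q.set := by
  have h := ((hV Q).2 e).1
  have hc : ENNReal.ofReal c₁ ≠ 0 := by simpa using hc₁
  have hp0 : 0 < p := by linarith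
  rw [mul_comm (ENNReal.ofReal c₁), ← ENNReal.le_div_iff_mul_le (Or.inl hc)
    (Or.inl ENNReal.ofReal_ne_top), redAvgD, ENNReal.div_eq_inv_mul] at h
  have h := ENNReal.rpow_le_rpow h hp0.le
  rw [← ENNReal.rpow_mul, one_div_mul_cancel hp0.ne', ENNReal.rpow_one,
    ENNReal.mul_rpow_of_nonneg _ _ hp0.le, ← DCube.volume_set,
    ENNReal.inv_mul_le_iff Q.volume_set_ne_zero Q.volume_set_ne_top] at h
  rwa [mul_comm]

lemma IsReducing.rpow_mul_volume_le (hV : IsReducing p c₁ c₂ W V) (hp : 1 < p)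
    (Q : DCube d) (e : EuclideanSpace ℂ (Fin n)) :
    ENNReal.ofReal ‖mApp (V Q) e‖ ^ p * volume Q.set ≤
      ENNReal.ofReal c₂ ^ p * ∫⁻ x in Q.set, ENNReal.ofReal ‖mApp (W x) e‖ ^ p := by
  have hp0 : 0 < p := by linarith
  have h := ENNReal.rpow_le_rpow ((hV Q).2 e).2 hp0.le
  rw [redAvgD, ENNReal.mul_rpow_of_nonneg _ _ hp0.le, ← ENNReal.rpow_mul,
    one_div_mul_cancel hp0.ne', ENNReal.rpow_one, ← DCube.volume_set] at h
  calc _ ≤ (ENNReal.ofReal c₂ ^ p * ((volume Q.set)⁻¹ *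
        ∫⁻ x in Q.set, ENNReal.ofReal ‖mApp (W x) e‖ ^ p)) * volume Q.set := by gcongr
    _ = ((volume Q.set)⁻¹ * volume Q.set) * (ENNReal.ofReal c₂ ^ p *
        ∫⁻ x in Q.set, ENNReal.ofReal ‖mApp (W x) e‖ ^ p) := by ring
    _ = _ := by rw [ENNReal.inv_mul_cancel Q.volume_set_ne_zero Q.volume_set_ne_top, one_mul]

lemma ofReal_matNorm_rpow_le {q : ℝ} (hq : 1 ≤ q) (A : Matrix (Fin n) (Fin n) ℂ) :
    ENNReal.ofReal (matNorm A) ^ q ≤ (n : ℝ≥0∞) ^ (q - 1) *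
      ∑ i, ENNReal.ofReal ‖mApp A (EuclideanSpace.single i 1)‖ ^ q := by
  calc ENNReal.ofReal (matNorm A) ^ q
      ≤ (∑ i, ENNReal.ofReal ‖mApp A (EuclideanSpace.single i 1)‖) ^ q := by
        refine ENNReal.rpow_le_rpow ?_ (by linarith)
        rw [← ENNReal.ofReal_sum_of_nonneg fun _ _ => norm_nonneg _]
        exact ENNReal.ofReal_le_ofReal (matNorm_le_sum A)
    _ ≤ _ := by
        have h := ENNReal.rpow_sum_le_const_mul_sum_rpow (Finset.univ : Finset (Fin n))
          (fun i => ENNReal.ofReal ‖mApp A (EuclideanSpace.single i 1)‖) hq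
        simpa using h

lemma lintegral_inv_mApp_rpow_le (hp : 1 < p)
    (hpos : ∀ᵐ x ∂(volume : Measure (Fin d → ℝ)), (W x).PosDef) (Q : DCube d)
    {x : Fin d → ℝ} (hx : (W x).PosDef) (w : EuclideanSpace ℂ (Fin n)) :
    ∫⁻ t in Q.set, ENNReal.ofReal ‖mApp (W t)⁻¹ (mApp (W x) w)‖ ^ (p / (p - 1)) ≤
      volume Q.set * apInner p W Q x * ENNReal.ofReal ‖w‖ ^ (p / (p - 1)) := by
  have hp' : 0 ≤ p / (p - 1) := div_nonneg (by linarith) (by linarith)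
  unfold apInner
  rw [← mul_assoc, ENNReal.mul_inv_cancel Q.volume_set_ne_zero Q.volume_set_ne_top, one_mul,
    ← lintegral_mul_const' (ENNReal.ofReal ‖w‖ ^ (p / (p - 1))) _
    (ENNReal.rpow_ne_top_of_nonneg hp' ENNReal.ofReal_ne_top)]
  refine lintegral_mono_ae (ae_restrict_of_ae ?_)
  filter_upwards [hpos] with t ht
  rw [← ENNReal.mul_rpow_of_nonneg _ _ hp', ← ENNReal.ofReal_mul (matNorm_nonneg _),
    matNorm_mul_comm_of_isHermitian hx.isHermitian ht.isHermitian.inv, ← mApp_mul]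
  exact ENNReal.rpow_le_rpow (ENNReal.ofReal_le_ofReal (norm_mApp_le _ _)) hp'

/-- Up to a factor `‖W‖_{A_p}^{1/p}`, the inverse of the reducing operator controls the dual
averages. -/
lemma IsReducing.lintegral_inv_mApp_rpow_le (hV : IsReducing p c₁ c₂ W V) (hp : 1 < p)
    (hW : MatMeasurable W)
    (hpos : ∀ᵐ x ∂(volume : Measure (Fin d → ℝ)), (W x).PosDef) (hap : apNorm p W < ⊤)
    (Q : DCube d) (v : EuclideanSpace ℂ (Fin n)) :
    ∫⁻ t in Q.set, ENNReal.ofReal ‖mApp (W t)⁻¹ (mApp (V Q) v)‖ ^ (p / (p - 1)) ≤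
      (ENNReal.ofReal c₂ * ENNReal.ofReal ‖v‖) ^ (p / (p - 1)) *
        apNorm p W ^ (1 / (p - 1)) * volume Q.set := by
  have hp0 : 0 < p := by linarith
  have hp1 : 0 < p - 1 := by linarith
  set p' := p / (p - 1) with hp'def
  have hp'0 : 0 < p' := div_pos hp0 hp1
  set μ := volume.restrict Q.set
  set G : EuclideanSpace ℂ (Fin n) → (Fin d → ℝ) → EuclideanSpace ℂ (Fin n) :=
    fun u t => mApp (W t)⁻¹ u with hG
  have hGm : ∀ u, AEStronglyMeasurable (G u) μ := fun u =>
    (measurable_mApp_comp (measurable_inv_entry hW) measurable_const).aestronglyMeasurable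
  have hp'1 : 1 ≤ ENNReal.ofReal p' := by
    rw [ENNReal.one_le_ofReal, hp'def, one_le_div hp1]; linarith
  have hnorm : ∀ u, eLpNorm (G u) (ENNReal.ofReal p') μ =
      (∫⁻ t in Q.set, ENNReal.ofReal ‖mApp (W t)⁻¹ u‖ ^ p') ^ (1 / p') := by
    intro u
    rw [eLpNorm_eq_lintegral_rpow_enorm_toReal (by simpa using hp'0) ENNReal.ofReal_ne_top,
      ENNReal.toReal_ofReal hp'0.le]
    simp only [hG, ofReal_norm]
    rfl
  have hpow : ∀ y : ℝ≥0∞, (y ^ (1 / p')) ^ p' = y := fun y => by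
    rw [← ENNReal.rpow_mul, one_div_mul_cancel hp'0.ne', ENNReal.rpow_one]
  have hpow' : ∀ y : ℝ≥0∞, (y ^ p') ^ (1 / p') = y := fun y => by
    rw [← ENNReal.rpow_mul, mul_one_div_cancel hp'0.ne', ENNReal.rpow_one]
  have hfin : ∀ u, eLpNorm (G u) (ENNReal.ofReal p') μ ≠ ⊤ := by
    intro u
    rw [hnorm]
    obtain ⟨x, -, hx, hx'⟩ :=
      Q.exists_mem_of_ae ((ae_restrict_of_ae hpos).and (ae_apInner_lt_top hp hW hap Q))
    have h := _root_.lintegral_inv_mApp_rpow_le hp hpos Q hx (mApp (W x)⁻¹ u)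
    rw [← mApp_mul (W x), hx.mul_inv_self, mApp_one] at h
    refine ENNReal.rpow_ne_top_of_nonneg (by positivity) (h.trans_lt ?_).ne
    exact ENNReal.mul_lt_top (ENNReal.mul_lt_top Q.volume_set_ne_top.lt_top hx')
      (ENNReal.rpow_lt_top_of_nonneg hp'0.le ENNReal.ofReal_ne_top)
  obtain ⟨e, he, he'⟩ := exists_re_inner_le
    (fun u => (eLpNorm (G u) (ENNReal.ofReal p') μ).toReal) (fun _ => ENNReal.toReal_nonneg)
    (fun c hc u => by
      have : G (c • u) = c • G u := by
        ext t : 1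
        simp only [hG, Pi.smul_apply, mApp]
        exact map_real_smul (Matrix.toEuclideanCLM (𝕜 := ℂ) (n := Fin n) (W t)⁻¹)
          (ContinuousLinearMap.continuous _) c u
      rw [this, eLpNorm_const_smul, ENNReal.toReal_mul]
      simp [abs_of_pos hc])
    (fun u v => by
      have : G (u + v) = G u + G v := by
        ext t : 1
        simp [hG, mApp]
      rw [this, ← ENNReal.toReal_add (hfin u) (hfin v)]
      exact ENNReal.toReal_mono (ENNReal.add_ne_top.2 ⟨hfin u, hfin v⟩)
        (eLpNorm_add_le (hGm u) (hGm v) hp'1))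
    (mApp (V Q) v)
  have hWe : ∀ᵐ x ∂μ, ENNReal.ofReal ‖mApp (W x) e‖ ^ p ≤
      volume Q.set ^ (p - 1) * apInner p W Q x ^ (p - 1) := by
    filter_upwards [ae_restrict_of_ae hpos] with x hx
    have h1 : ENNReal.ofReal ‖mApp (W x) e‖ ≤
        (volume Q.set * apInner p W Q x) ^ (1 / p') := by
      have h := he (mApp (W x) (mApp (W x) e))
      rw [← inner_mApp_left hx.isHermitian, inner_self_eq_norm_sq] at h
      have h := (ENNReal.ofReal_le_iff_le_toReal (hfin _)).2 h
      rw [hnorm] at h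
      have h := h.trans (ENNReal.rpow_le_rpow
        (_root_.lintegral_inv_mApp_rpow_le hp hpos Q hx (mApp (W x) e)) (by positivity))
      rw [ENNReal.mul_rpow_of_nonneg _ _ (by positivity : 0 ≤ 1 / p'), hpow', sq,
        ENNReal.ofReal_mul (norm_nonneg _)] at h
      by_cases h0 : ENNReal.ofReal ‖mApp (W x) e‖ = 0
      · rw [h0]; exact zero_le
      · exact (ENNReal.mul_le_mul_iff_left h0 ENNReal.ofReal_ne_top).1 h
    calc _ ≤ ((volume Q.set * apInner p W Q x) ^ (1 / p')) ^ p := by gcongr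
      _ = _ := by
        rw [← ENNReal.rpow_mul, ← ENNReal.mul_rpow_of_nonneg _ _ hp1.le]
        congr 1
        rw [hp'def]
        field_simp
  have hVe : ENNReal.ofReal ‖mApp (V Q) e‖ ^ p ≤
      ENNReal.ofReal c₂ ^ p * (volume Q.set ^ (p - 1) * apNorm p W) := by
    refine (ENNReal.mul_le_mul_iff_left Q.volume_set_ne_zero Q.volume_set_ne_top).1 ?_
    refine (hV.rpow_mul_volume_le hp Q e).trans ?_
    rw [mul_assoc, mul_assoc]
    refine mul_le_mul' le_rfl ?_
    refine (lintegral_mono_ae hWe).trans ?_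
    rw [lintegral_const_mul _ ((measurable_apInner hW Q).pow_const _)]
    exact mul_le_mul' le_rfl (lintegral_apInner_rpow_le hp Q)
  have hVe' : ENNReal.ofReal ‖mApp (V Q) e‖ ^ p' ≤
      ENNReal.ofReal c₂ ^ p' * (volume Q.set * apNorm p W ^ (1 / (p - 1))) := by
    have h := ENNReal.rpow_le_rpow hVe (one_div_nonneg.2 hp1.le)
    rw [← ENNReal.rpow_mul, ENNReal.mul_rpow_of_nonneg _ _ (one_div_nonneg.2 hp1.le),
      ENNReal.mul_rpow_of_nonneg _ _ (one_div_nonneg.2 hp1.le), ← ENNReal.rpow_mul,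
      ← ENNReal.rpow_mul, mul_one_div_cancel hp1.ne', ENNReal.rpow_one, mul_one_div] at h
    exact h
  have hmain : eLpNorm (G (mApp (V Q) v)) (ENNReal.ofReal p') μ ≤
      ENNReal.ofReal ‖mApp (V Q) e‖ * ENNReal.ofReal ‖v‖ := by
    rw [← ENNReal.ofReal_mul (norm_nonneg _), ENNReal.le_ofReal_iff_toReal_le (hfin _)
      (by positivity)]
    refine he'.symm.le.trans ?_
    rw [← inner_mApp_left (hV Q).1.isHermitian]
    exact re_inner_le_norm _ _
  have h := ENNReal.rpow_le_rpow hmain hp'0.le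
  rw [hnorm, hpow, ENNReal.mul_rpow_of_nonneg _ _ hp'0.le] at h
  refine h.trans ((mul_le_mul' hVe' le_rfl).trans_eq ?_)
  rw [ENNReal.mul_rpow_of_nonneg _ _ hp'0.le]
  ring

lemma IsReducing.lintegral_invNorm_rpow_le (hV : IsReducing p c₁ c₂ W V) (hp : 1 < p)
    (hW : MatMeasurable W)
    (hpos : ∀ᵐ x ∂(volume : Measure (Fin d → ℝ)), (W x).PosDef) (hap : apNorm p W < ⊤)
    (Q : DCube d) :
    ∫⁻ t in Q.set, invNorm W (V Q) t ^ (p / (p - 1)) ≤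
      (n * ENNReal.ofReal c₂) ^ (p / (p - 1)) * apNorm p W ^ (1 / (p - 1)) * volume Q.set := by
  have hp0 : 0 < p := by linarith
  have hp1 : 0 < p - 1 := by linarith
  set p' := p / (p - 1) with hp'def
  have hp'1 : 1 ≤ p' := by rw [hp'def, one_le_div hp1]; linarith
  have hm : ∀ i : Fin n, Measurable fun t =>
      ENNReal.ofReal ‖mApp ((W t)⁻¹ * V Q) (EuclideanSpace.single i 1)‖ ^ p' := fun i =>
    (ENNReal.measurable_ofReal.comp (measurable_mApp_comp (F := fun t => (W t)⁻¹ * V Q)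
      (f := fun _ => EuclideanSpace.single i 1) (measurable_mul_entry (F := fun t => (W t)⁻¹)
      (G := fun _ => V Q) (measurable_inv_entry hW) fun _ _ => measurable_const)
      measurable_const).norm).pow_const _
  calc ∫⁻ t in Q.set, invNorm W (V Q) t ^ p'
      ≤ ∫⁻ t in Q.set, (n : ℝ≥0∞) ^ (p' - 1) * ∑ i,
          ENNReal.ofReal ‖mApp ((W t)⁻¹ * V Q) (EuclideanSpace.single i 1)‖ ^ p' :=
        lintegral_mono fun t => ofReal_matNorm_rpow_le hp'1 _
    _ = (n : ℝ≥0∞) ^ (p' - 1) * ∑ i, ∫⁻ t in Q.set,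
          ENNReal.ofReal ‖mApp (W t)⁻¹ (mApp (V Q) (EuclideanSpace.single i 1))‖ ^ p' := by
        rw [lintegral_const_mul _ (Finset.measurable_sum _ fun i _ => hm i),
          lintegral_finsetSum _ fun i _ => hm i]
        simp only [mApp_mul]
    _ ≤ (n : ℝ≥0∞) ^ (p' - 1) * ∑ i : Fin n, ENNReal.ofReal c₂ ^ p' *
        apNorm p W ^ (1 / (p - 1)) * volume Q.set := by
        gcongr with i
        simpa using hV.lintegral_inv_mApp_rpow_le hp hW hpos hap Q (EuclideanSpace.single i 1)
    _ = (n : ℝ≥0∞) ^ (p' - 1) * n * (ENNReal.ofReal c₂ ^ p' *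
        apNorm p W ^ (1 / (p - 1)) * volume Q.set) := by
        simp [mul_assoc]
    _ = _ := by
        rw [ENNReal.mul_rpow_of_nonneg _ _ (by linarith)]
        rcases Nat.eq_zero_or_pos n with h | h
        · subst h
          simp [show 0 < p' by linarith]
        · have : (n : ℝ≥0∞) ^ (p' - 1) * n = n ^ p' := by
            conv_lhs => rw [← ENNReal.rpow_one (n : ℝ≥0∞)]
            rw [← ENNReal.rpow_mul, ← ENNReal.rpow_add _ _ (by simpa using h.ne')
              (ENNReal.natCast_ne_top n)]
            ring_nf
          rw [this]
          ring

/-- Cubes on which the reducing operator is much larger than on `Q` are sparse. -/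
lemma IsReducing.rpow_mul_volume_biUnion_le (hV : IsReducing p c₁ c₂ W V) (hd : 0 < d)
    (hp : 1 < p) (hc₁ : 0 < c₁) (hW : MatMeasurable W) (Q : DCube d) {B : Set (DCube d)} {l : ℝ}
    (hBQ : ∀ J ∈ B, J.set ⊆ Q.set) (hB : ∀ J ∈ B, l ≤ matNorm (V J * (V Q)⁻¹)) :
    ENNReal.ofReal l ^ p * volume (⋃ J ∈ B, J.set) ≤
      (n : ℝ≥0∞) ^ p * ENNReal.ofReal c₂ ^ p * (ENNReal.ofReal c₁)⁻¹ ^ p * volume Q.set := by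
  have hp0 : 0 < p := by linarith
  set u : Fin n → EuclideanSpace ℂ (Fin n) := fun i => mApp (V Q)⁻¹ (EuclideanSpace.single i 1)
  have hm : ∀ i : Fin n, Measurable fun x => ENNReal.ofReal ‖mApp (W x) (u i)‖ ^ p := fun i =>
    (ENNReal.measurable_ofReal.comp (measurable_mApp_comp hW measurable_const).norm).pow_const _
  have hint : ∀ J : DCube d, ∫⁻ x in J.set, (n : ℝ≥0∞) ^ (p - 1) * (ENNReal.ofReal c₂ ^ p *
      ∑ i, ENNReal.ofReal ‖mApp (W x) (u i)‖ ^ p) = (n : ℝ≥0∞) ^ (p - 1) *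
      (ENNReal.ofReal c₂ ^ p * ∑ i, ∫⁻ x in J.set, ENNReal.ofReal ‖mApp (W x) (u i)‖ ^ p) := by
    intro J
    have := Finset.measurable_sum Finset.univ fun i _ => hm i
    rw [lintegral_const_mul _ (this.const_mul _), lintegral_const_mul _ this,
      lintegral_finsetSum _ fun i _ => hm i]
  refine (DCube.mul_volume_biUnion_le hd hBQ (u := fun x => (n : ℝ≥0∞) ^ (p - 1) *
    (ENNReal.ofReal c₂ ^ p * ∑ i, ENNReal.ofReal ‖mApp (W x) (u i)‖ ^ p)) fun J hJ => ?_).trans ?_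
  · rw [hint, Finset.mul_sum]
    calc ENNReal.ofReal l ^ p * volume J.set
        ≤ ENNReal.ofReal (matNorm (V J * (V Q)⁻¹)) ^ p * volume J.set := by
          gcongr; exact hB J hJ
      _ ≤ ((n : ℝ≥0∞) ^ (p - 1) * ∑ i, ENNReal.ofReal ‖mApp (V J) (u i)‖ ^ p) *
          volume J.set := by
          gcongr
          simpa only [mApp_mul] using ofReal_matNorm_rpow_le hp.le (V J * (V Q)⁻¹)
      _ = (n : ℝ≥0∞) ^ (p - 1) * ∑ i, ENNReal.ofReal ‖mApp (V J) (u i)‖ ^ p * volume J.set := by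
          rw [mul_assoc, Finset.sum_mul]
      _ ≤ _ := by
          refine mul_le_mul' le_rfl ?_
          exact Finset.sum_le_sum fun i _ => hV.rpow_mul_volume_le hp J (u i)
  · rw [hint]
    calc _ ≤ (n : ℝ≥0∞) ^ (p - 1) * (ENNReal.ofReal c₂ ^ p * ∑ i : Fin n,
          (ENNReal.ofReal c₁)⁻¹ ^ p * 1 * volume Q.set) := by
          gcongr with i
          refine (hV.lintegral_rpow_le hp hc₁ Q (u i)).trans_eq ?_
          have : mApp (V Q) (u i) = EuclideanSpace.single i 1 := by
            rw [← mApp_mul, (hV Q).1.mul_inv_self, mApp_one]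
          simp [this]
      _ = (n : ℝ≥0∞) ^ (p - 1) * n * (ENNReal.ofReal c₂ ^ p *
          ((ENNReal.ofReal c₁)⁻¹ ^ p * volume Q.set)) := by
          simp; ring
      _ = _ := by
        rcases Nat.eq_zero_or_pos n with h | h
        · subst h
          simp [hp0]
        · have : (n : ℝ≥0∞) ^ (p - 1) * n = n ^ p := by
            conv_lhs => rw [← ENNReal.rpow_one (n : ℝ≥0∞)]
            rw [← ENNReal.rpow_mul, ← ENNReal.rpow_add _ _ (by simpa using h.ne')
              (ENNReal.natCast_ne_top n)]
            ring_nf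
          rw [this]
          ring

end Weight

/-! ## Stopping cubes for a locally integrable function -/

lemma DCube.tsum_indicator_tower_le {d : ℕ} {x : Fin d → ℝ} {G : Set (DCube d)}
    (hx : ∀ I ∈ G, x ∈ I.set) {φ : DCube d → ℝ≥0∞} {A : ℝ≥0∞}
    (h : ∀ I ∈ G, ∑' K, {K : DCube d | I.set ⊆ K.set ∧ K ∈ G}.indicator φ K ≤ A) :
    ∑' K, G.indicator φ K ≤ A := by
  classical
  rw [ENNReal.tsum_eq_iSup_sum]
  refine iSup_le fun T => ?_
  have hT : ∑ K ∈ T, G.indicator φ K = ∑ K ∈ T.filter (· ∈ G), φ K := by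
    rw [Finset.sum_filter]
    rfl
  rw [hT]
  rcases (T.filter (· ∈ G)).eq_empty_or_nonempty with h0 | h0
  · simp [h0]
  obtain ⟨I, hI, hmin⟩ := (T.filter (· ∈ G)).exists_min_image DCube.k h0
  have hIG := (Finset.mem_filter.1 hI).2
  refine le_trans ?_ (h I hIG)
  refine le_trans (Finset.sum_le_sum fun K hK => ?_) (ENNReal.sum_le_tsum (T.filter (· ∈ G)))
  have hKG := (Finset.mem_filter.1 hK).2
  rw [Set.indicator_of_mem]
  exact ⟨DCube.subset_of_mem (hmin K hK) (hx I hIG) (hx K hKG), hKG⟩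

section Unweighted

variable {d n : ℕ}

/-- The average of `‖g‖` over a cube. -/
def meanNorm (g : (Fin d → ℝ) → EuclideanSpace ℂ (Fin n)) (Q : DCube d) : ℝ≥0∞ :=
  (volume Q.set)⁻¹ * ∫⁻ x in Q.set, ‖g x‖ₑ

lemma meanNorm_mul_volume (g : (Fin d → ℝ) → EuclideanSpace ℂ (Fin n)) (Q : DCube d) :
    meanNorm g Q * volume Q.set = ∫⁻ x in Q.set, ‖g x‖ₑ := by
  rw [meanNorm, mul_comm, ← mul_assoc, ENNReal.mul_inv_cancel Q.volume_set_ne_zero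
    Q.volume_set_ne_top, one_mul]

/-- The cubes inside `Q` all of whose ancestors inside `Q` have a controlled average. -/
def controlled (κ : ℝ≥0∞) (g : (Fin d → ℝ) → EuclideanSpace ℂ (Fin n)) (Q : DCube d) :
    Set (DCube d) :=
  {J | ∀ K : DCube d, J.set ⊆ K.set → K.set ⊆ Q.set →
    ∫⁻ x in K.set, ‖g x‖ₑ ≤ κ * meanNorm g Q * volume K.set}

/-- The part of the square function of `g` coming from the cubes between `J` and `Q`. -/
def towerEnergy (g : (Fin d → ℝ) → EuclideanSpace ℂ (Fin n)) (Q J : DCube d) : ℝ≥0∞ :=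
  ∑' I, {I : DCube d | J.set ⊆ I.set ∧ I.set ⊆ Q.set}.indicator
    (fun I => haarEnergy g I / volume I.set) I

/-- The threshold for `towerEnergy`. -/
def energyConst (d : ℕ) (κ : ℝ≥0∞) : ℝ≥0∞ := ((Sfin d).card + 1) * 2 ^ d * κ ^ 2

/-- The dyadic subcubes of `Q` over which the average of `‖g‖` is large. -/
def largeMean (κ : ℝ≥0∞) (g : (Fin d → ℝ) → EuclideanSpace ℂ (Fin n)) (Q : DCube d) :
    Set (DCube d) :=
  {J | J.set ⊆ Q.set ∧ κ * meanNorm g Q * volume J.set < ∫⁻ x in J.set, ‖g x‖ₑ}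

/-- The controlled dyadic subcubes of `Q` over which the square function of `g` is large. -/
def largeEnergy (κ : ℝ≥0∞) (N : ℤ) (g : (Fin d → ℝ) → EuclideanSpace ℂ (Fin n))
    (Q : DCube d) : Set (DCube d) :=
  {J | J.set ⊆ Q.set ∧ J ∈ controlled κ g Q ∧ N ≤ J.k ∧
    energyConst d κ * meanNorm g Q ^ 2 < towerEnergy g Q J}

variable {g : (Fin d → ℝ) → EuclideanSpace ℂ (Fin n)} {Q : DCube d} {κ : ℝ≥0∞} {N : ℤ}

lemma meanNorm_ne_top (hg : IntegrableOn g Q.set) : meanNorm g Q ≠ ⊤ :=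
  ENNReal.mul_ne_top (ENNReal.inv_ne_top.2 Q.volume_set_ne_zero) hg.2.ne

lemma mul_volume_largeMean_le (hd : 0 < d) (hg : IntegrableOn g Q.set) :
    κ * volume (⋃ J ∈ largeMean κ g Q, J.set) ≤ volume Q.set := by
  have h := DCube.mul_volume_biUnion_le hd (B := largeMean κ g Q) (fun J hJ => hJ.1)
    (u := fun x => ‖g x‖ₑ) (fun J hJ => hJ.2.le)
  rw [← meanNorm_mul_volume, mul_comm κ, mul_assoc] at h
  by_cases h0 : meanNorm g Q = 0
  · have : largeMean κ g Q = ∅ := by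
      refine Set.eq_empty_of_forall_notMem fun J hJ => ?_
      have h1 := hJ.2.trans_le (lintegral_mono_set hJ.1)
      rw [← meanNorm_mul_volume g Q, h0] at h1
      simp at h1
    simp [this]
  · exact (ENNReal.mul_le_mul_iff_right h0 (meanNorm_ne_top hg)).1 h

lemma tsum_haarEnergy_controlled_le (hd : 0 < d) (hg : IntegrableOn g Q.set) (hκ : 1 ≤ κ) :
    ∑' J, {J : DCube d | J.set ⊆ Q.set ∧ J ∈ controlled κ g Q ∧ N ≤ J.k}.indicator
      (haarEnergy g) J ≤ (Sfin d).card * 2 ^ d * κ * meanNorm g Q ^ 2 * volume Q.set := by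
  have hQ : ∫⁻ x in Q.set, ‖g x‖ₑ ≤ 2 ^ d * (κ * meanNorm g Q) * volume Q.set := by
    rw [← meanNorm_mul_volume]
    refine mul_le_mul' ?_ le_rfl
    calc meanNorm g Q = 1 * (1 * meanNorm g Q) := by simp
      _ ≤ _ := by
        gcongr
        exact one_le_pow₀ (by norm_num)
  refine le_self_add.trans ((tsum_haarEnergy_add_le hd hg (F := controlled κ g Q) (N := N)
    (Λ := κ * meanNorm g Q) (fun J hJ hJQ => hJ J subset_rfl hJQ)
    (fun I J hJ hJI _ K hK hKQ => hJ K (hJI.trans hK) hKQ) subset_rfl hQ).trans_eq ?_)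
  rw [← meanNorm_mul_volume]
  ring

lemma mul_volume_largeEnergy_le (hd : 0 < d) (hg : IntegrableOn g Q.set) (hκ : 1 ≤ κ)
    (hκt : κ ≠ ⊤) : κ * volume (⋃ J ∈ largeEnergy κ N g Q, J.set) ≤ volume Q.set := by
  set G : Set (DCube d) := {J | J.set ⊆ Q.set ∧ J ∈ controlled κ g Q ∧ N ≤ J.k}
  set u : (Fin d → ℝ) → ℝ≥0∞ := fun x => ∑' I, G.indicator
    (fun I : DCube d => I.set.indicator (fun _ => haarEnergy g I / volume I.set) x) I
  have hu : ∀ E : Set (Fin d → ℝ), ∫⁻ x in E, u x = ∑' I, G.indicator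
      (fun I : DCube d => haarEnergy g I / volume I.set * volume (I.set ∩ E)) I := by
    intro E
    rw [lintegral_tsum]
    · refine tsum_congr fun I => ?_
      by_cases hI : I ∈ G
      · simp only [Set.indicator_of_mem hI]
        rw [lintegral_indicator_const I.measurableSet_set,
          Measure.restrict_apply I.measurableSet_set]
      · simp [Set.indicator_of_notMem hI]
    · intro I
      by_cases hI : I ∈ G
      · simp only [Set.indicator_of_mem hI]
        exact (measurable_const.indicator I.measurableSet_set).aemeasurable
      · simp [Set.indicator_of_notMem hI]
  have huQ : ∫⁻ x in Q.set, u x ≤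
      (Sfin d).card * 2 ^ d * κ * meanNorm g Q ^ 2 * volume Q.set := by
    refine le_trans (le_of_eq ?_) (tsum_haarEnergy_controlled_le hd hg hκ (N := N))
    rw [hu]
    refine tsum_congr fun I => ?_
    by_cases hI : I ∈ G
    · rw [Set.indicator_of_mem hI, Set.indicator_of_mem hI, Set.inter_eq_left.2 hI.1,
        ENNReal.div_mul_cancel I.volume_set_ne_zero I.volume_set_ne_top]
    · rw [Set.indicator_of_notMem hI, Set.indicator_of_notMem hI]
  have huJ : ∀ J ∈ largeEnergy κ N g Q, towerEnergy g Q J * volume J.set ≤ ∫⁻ x in J.set, u x := by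
    intro J hJ
    rw [hu, towerEnergy, ← ENNReal.tsum_mul_right]
    refine ENNReal.tsum_le_tsum fun I => ?_
    by_cases hI : I ∈ {I : DCube d | J.set ⊆ I.set ∧ I.set ⊆ Q.set}
    · have hIG : I ∈ G := ⟨hI.2, fun K hK hKQ => hJ.2.1 K (hI.1.trans hK) hKQ,
        hJ.2.2.1.trans (DCube.k_le_of_subset hd hI.1)⟩
      rw [Set.indicator_of_mem hI, Set.indicator_of_mem hIG, Set.inter_eq_right.2 hI.1]
    · simp [Set.indicator_of_notMem hI]
  by_cases h0 : meanNorm g Q = 0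
  · have : largeEnergy κ N g Q = ∅ := by
      refine Set.eq_empty_of_forall_notMem fun J hJ => ?_
      have h1 := (huJ J hJ).trans ((lintegral_mono_set hJ.1).trans huQ)
      rw [h0] at h1
      have h2 := hJ.2.2.2
      simp only [ne_eq, OfNat.ofNat_ne_zero, not_false_eq_true, zero_pow, mul_zero, zero_mul,
        nonpos_iff_eq_zero, mul_eq_zero, J.volume_set_ne_zero, or_false] at h1
      rw [h1] at h2
      exact _root_.not_lt_zero h2
    simp [this]
  · have h := (DCube.mul_volume_biUnion_le hd (B := largeEnergy κ N g Q) (fun J hJ => hJ.1)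
      (c := energyConst d κ * meanNorm g Q ^ 2) (u := u)
      (fun J hJ => (mul_le_mul' hJ.2.2.2.le le_rfl).trans (huJ J hJ))).trans huQ
    set c : ℝ≥0∞ := ((Sfin d).card + 1) * 2 ^ d * κ * meanNorm g Q ^ 2 with hc
    have hc0 : c ≠ 0 := by
      have : κ ≠ 0 := (zero_lt_one.trans_le hκ).ne'
      simp [hc, this, h0]
    have hct : c ≠ ⊤ := by
      rw [hc]
      refine ENNReal.mul_ne_top (ENNReal.mul_ne_top (ENNReal.mul_ne_top (by simp) (by simp)) hκt)
        (ENNReal.pow_ne_top (meanNorm_ne_top hg))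
    refine (ENNReal.mul_le_mul_iff_right hc0 hct).1 ?_
    calc c * (κ * volume (⋃ J ∈ largeEnergy κ N g Q, J.set))
        = energyConst d κ * meanNorm g Q ^ 2 * volume (⋃ J ∈ largeEnergy κ N g Q, J.set) := by
          rw [hc, energyConst]; ring
      _ ≤ (Sfin d).card * 2 ^ d * κ * meanNorm g Q ^ 2 * volume Q.set := h
      _ ≤ c * volume Q.set := by
          rw [hc]
          gcongr
          exact le_self_add

lemma towerEnergy_self_le (hd : 0 < d) (hg : IntegrableOn g Q.set) (hκ : 1 ≤ κ) :
    towerEnergy g Q Q ≤ energyConst d κ * meanNorm g Q ^ 2 := by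
  have h1 : towerEnergy g Q Q = haarEnergy g Q / volume Q.set := by
    rw [towerEnergy, tsum_eq_single Q]
    · simp
    · intro I hI
      refine Set.indicator_of_notMem (fun h => hI ?_) _
      exact DCube.eq_of_subset h.2
        (le_antisymm (DCube.k_le_of_subset hd h.2) (DCube.k_le_of_subset hd h.1))
  rw [h1]
  refine ENNReal.div_le_of_le_mul ?_
  have hQ : Q ∈ {J : DCube d | J.set ⊆ Q.set ∧ J ∈ controlled κ g Q ∧ Q.k ≤ J.k} := by
    refine ⟨subset_rfl, fun K hK hKQ => ?_, le_rfl⟩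
    rw [show K.set = Q.set from hKQ.antisymm hK, ← meanNorm_mul_volume]
    refine mul_le_mul' ?_ le_rfl
    exact le_mul_of_one_le_left' hκ
  calc haarEnergy g Q = {J : DCube d | J.set ⊆ Q.set ∧ J ∈ controlled κ g Q ∧ Q.k ≤ J.k}.indicator
        (haarEnergy g) Q := (Set.indicator_of_mem hQ _).symm
    _ ≤ _ := ENNReal.le_tsum Q
    _ ≤ _ := tsum_haarEnergy_controlled_le hd hg hκ
    _ ≤ _ := by
      rw [energyConst]
      gcongr
      · exact le_self_add
      · exact le_self_pow hκ two_ne_zero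

end Unweighted

/-! ## Haar coefficients of functions in `L^p(W)` -/

section Coefficients

variable {d n : ℕ} {p : ℝ} {W : (Fin d → ℝ) → Matrix (Fin n) (Fin n) ℂ}
  {f : (Fin d → ℝ) → EuclideanSpace ℂ (Fin n)}

lemma enorm_mApp_le_invNorm_mul {M : Matrix (Fin n) (Fin n) ℂ} (hM : M.IsHermitian)
    {x : Fin d → ℝ} (hx : (W x).PosDef) (v : EuclideanSpace ℂ (Fin n)) :
    ‖mApp M v‖ₑ ≤ invNorm W M x * ENNReal.ofReal ‖mApp (W x) v‖ := by
  rw [invNorm, ← ENNReal.ofReal_mul (matNorm_nonneg _), ← ofReal_norm,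
    matNorm_mul_comm_of_isHermitian hx.isHermitian.inv hM]
  refine ENNReal.ofReal_le_ofReal ?_
  calc ‖mApp M v‖ = ‖mApp (M * (W x)⁻¹) (mApp (W x) v)‖ := by
        rw [← mApp_mul, mul_assoc, hx.inv_mul_self, mul_one]
    _ ≤ _ := norm_mApp_le _ _

lemma lintegral_enorm_mApp_le (hpos : ∀ᵐ x ∂(volume : Measure (Fin d → ℝ)), (W x).PosDef)
    {M : Matrix (Fin n) (Fin n) ℂ} (hM : M.IsHermitian) (Q : DCube d) :
    ∫⁻ x in Q.set, ‖mApp M (f x)‖ₑ ≤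
      ∫⁻ x in Q.set, invNorm W M x * ENNReal.ofReal ‖mApp (W x) (f x)‖ := by
  refine lintegral_mono_ae (ae_restrict_of_ae ?_)
  filter_upwards [hpos] with x hx
  exact enorm_mApp_le_invNorm_mul hM hx _

lemma measurable_ofReal_norm_mApp (hW : MatMeasurable W) (hf : StronglyMeasurable f) :
    Measurable fun x => ENNReal.ofReal ‖mApp (W x) (f x)‖ :=
  ENNReal.measurable_ofReal.comp (measurable_mApp_comp hW hf.measurable).norm

lemma integrableOn_of_wNorm (hp : 1 < p) (hW : MatMeasurable W)
    (hpos : ∀ᵐ x ∂(volume : Measure (Fin d → ℝ)), (W x).PosDef) (hap : apNorm p W < ⊤)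
    (hf : StronglyMeasurable f)
    (hfp : ∫⁻ x, ENNReal.ofReal ‖mApp (W x) (f x)‖ ^ p ≠ ⊤) (Q : DCube d) :
    IntegrableOn f Q.set := by
  refine ⟨hf.aestronglyMeasurable, ?_⟩
  have hpp : (p / (p - 1)).HolderConjugate p := (Real.HolderConjugate.conjExponent hp).symm
  have h1 := lintegral_enorm_mApp_le (f := f) hpos (Matrix.isHermitian_one (n := Fin n)) Q
  simp only [mApp_one] at h1
  refine h1.trans_lt ((setLIntegral_mul_le_Lp_mul_Lq hpp (measurable_invNorm hW 1)
    (measurable_ofReal_norm_mApp hW hf) Q.set).trans_lt ?_)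
  refine ENNReal.mul_lt_top
    (ENNReal.rpow_lt_top_of_nonneg (one_div_nonneg.2 hpp.pos.le)
      (invNorm_rpow_lintegral_ne_top hp hW hpos hap Q 1))
    (ENNReal.rpow_lt_top_of_nonneg (one_div_nonneg.2 hpp.symm.pos.le)
      ((setLIntegral_le_lintegral _ _).trans_lt hfp.lt_top).ne)

lemma integrableOn_mApp {E : Set (Fin d → ℝ)} (hf : IntegrableOn f E)
    (M : Matrix (Fin n) (Fin n) ℂ) : IntegrableOn (fun x => mApp M (f x)) E :=
  (Matrix.toEuclideanCLM (𝕜 := ℂ) (n := Fin n) M).integrable_comp hf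

lemma haarCoef_mApp {I : DCube d} (hf : IntegrableOn f I.set) (M : Matrix (Fin n) (Fin n) ℂ)
    (ε : Fin d → Bool) :
    haarCoef (fun x => mApp M (f x)) I ε = mApp M (haarCoef f I ε) := by
  rw [haarCoef_eq_sum_child (integrableOn_mApp hf M), haarCoef_eq_sum_child hf]
  set T := Matrix.toEuclideanCLM (𝕜 := ℂ) (n := Fin n) M with hT
  have hsmul : ∀ (c : ℝ) (v : EuclideanSpace ℂ (Fin n)), T (c • v) = c • T v :=
    fun c v => map_real_smul T T.continuous c v
  have hint : ∀ η, ∫ x in (I.child η).set, mApp M (f x) = T (∫ x in (I.child η).set, f x) :=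
    fun η => T.integral_comp_comm (hf.mono_set (I.child_subset η))
  simp only [hint]
  change _ = T _
  rw [hsmul, map_sum]
  simp only [hsmul]

end Coefficients

/-! ## The weighted stopping time -/

/-- The contribution of the cube `I` to the square function. -/
def sqTerm {d n : ℕ} (V : DCube d → Matrix (Fin n) (Fin n) ℂ)
    (f : (Fin d → ℝ) → EuclideanSpace ℂ (Fin n)) (I : DCube d) : ℝ≥0∞ :=
  haarEnergy (fun x => mApp (V I) (f x)) I / volume I.set

/-- The part of the square function coming from the subcubes of `Q` of scale at least `N`. -/
def localSq {d n : ℕ} (V : DCube d → Matrix (Fin n) (Fin n) ℂ)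
    (f : (Fin d → ℝ) → EuclideanSpace ℂ (Fin n)) (N : ℤ) (Q : DCube d) (x : Fin d → ℝ) : ℝ≥0∞ :=
  ∑' I, {I : DCube d | x ∈ I.set ∧ I.set ⊆ Q.set ∧ N ≤ I.k}.indicator (sqTerm V f) I

/-- The strict subcubes of `Q` at which the stopping time stops. -/
def stopCubes {d n : ℕ} (κ : ℝ≥0∞) (l : ℝ) (N : ℤ) (V : DCube d → Matrix (Fin n) (Fin n) ℂ)
    (f : (Fin d → ℝ) → EuclideanSpace ℂ (Fin n)) (Q : DCube d) : Set (DCube d) :=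
  {J | J.set ⊆ Q.set ∧ J ≠ Q ∧ N ≤ J.k ∧
    (J ∈ largeMean κ (fun x => mApp (V Q) (f x)) Q ∨ l ≤ matNorm (V J * (V Q)⁻¹) ∨
      energyConst d κ * meanNorm (fun x => mApp (V Q) (f x)) Q ^ 2 <
        towerEnergy (fun x => mApp (V Q) (f x)) Q J)}

section Stopping

variable {d n : ℕ} {p c₁ c₂ l : ℝ} {κ : ℝ≥0∞} {N : ℤ}
  {W : (Fin d → ℝ) → Matrix (Fin n) (Fin n) ℂ} {V : DCube d → Matrix (Fin n) (Fin n) ℂ}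
  {f : (Fin d → ℝ) → EuclideanSpace ℂ (Fin n)}

lemma volume_stopCubes_le (hd : 0 < d) (hn : 0 < n) (hp : 1 < p) (hc₁ : 0 < c₁) (hc₂ : 0 < c₂)
    (hW : MatMeasurable W) (hV : IsReducing p c₁ c₂ W V) (hκ : 1 ≤ κ) (hκt : κ ≠ ⊤)
    (hl : κ * ((n : ℝ≥0∞) ^ p * ENNReal.ofReal c₂ ^ p * (ENNReal.ofReal c₁)⁻¹ ^ p) ≤
      ENNReal.ofReal l ^ p) {Q : DCube d} (hf : IntegrableOn f Q.set) :
    κ * volume (⋃ J ∈ stopCubes κ l N V f Q, J.set) ≤ 3 * volume Q.set := by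
  have hg := integrableOn_mApp hf (V Q)
  set g := fun x => mApp (V Q) (f x)
  set B : Set (DCube d) := {J | J.set ⊆ Q.set ∧ l ≤ matNorm (V J * (V Q)⁻¹)}
  have hsub : (⋃ J ∈ stopCubes κ l N V f Q, J.set) ⊆ (⋃ J ∈ largeMean κ g Q, J.set) ∪
      ((⋃ J ∈ B, J.set) ∪ ⋃ J ∈ largeEnergy κ N g Q, J.set) := by
    refine Set.iUnion₂_subset fun J hJ => ?_
    obtain ⟨hJQ, -, hJN, h | h | h⟩ := hJ
    · exact (Set.subset_biUnion_of_mem (u := DCube.set) h).trans Set.subset_union_left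
    · exact ((Set.subset_biUnion_of_mem (u := DCube.set) (show J ∈ B from ⟨hJQ, h⟩)).trans
        Set.subset_union_left).trans Set.subset_union_right
    · by_cases hF : J ∈ controlled κ g Q
      · exact ((Set.subset_biUnion_of_mem (u := DCube.set)
          (show J ∈ largeEnergy κ N g Q from ⟨hJQ, hF, hJN, h⟩)).trans
          Set.subset_union_right).trans Set.subset_union_right
      · simp only [controlled, Set.mem_ofPred_eq, not_forall, not_le] at hF
        obtain ⟨K, hJK, hKQ, hK⟩ := hF
        exact (hJK.trans (Set.subset_biUnion_of_mem (u := DCube.set)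
          (show K ∈ largeMean κ g Q from ⟨hKQ, hK⟩))).trans Set.subset_union_left
  have hB : κ * volume (⋃ J ∈ B, J.set) ≤ volume Q.set := by
    have h := hV.rpow_mul_volume_biUnion_le hd hp hc₁ hW Q (B := B) (fun J hJ => hJ.1)
      fun J hJ => hJ.2
    set X : ℝ≥0∞ := (n : ℝ≥0∞) ^ p * ENNReal.ofReal c₂ ^ p * (ENNReal.ofReal c₁)⁻¹ ^ p
    have hn' : (n : ℝ≥0∞) ≠ 0 := by simpa using hn.ne'
    have hc₁' : (ENNReal.ofReal c₁)⁻¹ ≠ ⊤ := ENNReal.inv_ne_top.2 (by simpa using hc₁)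
    have hX0 : X ≠ 0 := mul_ne_zero (mul_ne_zero
      (ENNReal.rpow_pos (pos_iff_ne_zero.2 hn') (ENNReal.natCast_ne_top n)).ne'
      (ENNReal.rpow_pos (by simpa using hc₂) ENNReal.ofReal_ne_top).ne')
      (ENNReal.rpow_pos (ENNReal.inv_pos.2 ENNReal.ofReal_ne_top) hc₁').ne'
    have hXt : X ≠ ⊤ := by
      have hp0 : 0 ≤ p := by linarith
      exact ENNReal.mul_ne_top (ENNReal.mul_ne_top
        (ENNReal.rpow_ne_top_of_nonneg hp0 (ENNReal.natCast_ne_top n))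
        (ENNReal.rpow_ne_top_of_nonneg hp0 ENNReal.ofReal_ne_top))
        (ENNReal.rpow_ne_top_of_nonneg hp0 hc₁')
    refine (ENNReal.mul_le_mul_iff_right hX0 hXt).1 (le_trans ?_ h)
    rw [← mul_assoc, mul_comm X]
    exact mul_le_mul' hl le_rfl
  calc κ * volume (⋃ J ∈ stopCubes κ l N V f Q, J.set)
      ≤ κ * (volume (⋃ J ∈ largeMean κ g Q, J.set) +
        (volume (⋃ J ∈ B, J.set) + volume (⋃ J ∈ largeEnergy κ N g Q, J.set))) := by
        refine mul_le_mul' le_rfl ((measure_mono hsub).trans ((measure_union_le _ _).trans ?_))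
        exact add_le_add le_rfl (measure_union_le _ _)
    _ ≤ volume Q.set + (volume Q.set + volume Q.set) := by
        rw [mul_add, mul_add]
        exact add_le_add (mul_volume_largeMean_le hd hg)
          (add_le_add hB (mul_volume_largeEnergy_le hd hg hκ hκt))
    _ = _ := by ring

lemma sqTerm_le {Q I : DCube d} (hV : (V Q).PosDef) (hf : IntegrableOn f I.set)
    (hl : matNorm (V I * (V Q)⁻¹) ≤ l) :
    sqTerm V f I ≤ ENNReal.ofReal (l ^ 2) *
      (haarEnergy (fun x => mApp (V Q) (f x)) I / volume I.set) := by
  rw [sqTerm, ← mul_div_assoc]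
  refine ENNReal.div_le_div_right ?_ _
  unfold haarEnergy
  rw [Finset.mul_sum]
  refine Finset.sum_le_sum fun ε _ => ?_
  rw [← ENNReal.ofReal_mul (sq_nonneg l), ← mul_pow, haarCoef_mApp hf, haarCoef_mApp hf]
  refine ENNReal.ofReal_le_ofReal (pow_le_pow_left₀ (norm_nonneg _) ?_ 2)
  calc ‖mApp (V I) (haarCoef f I ε)‖
      = ‖mApp (V I * (V Q)⁻¹) (mApp (V Q) (haarCoef f I ε))‖ := by
        rw [← mApp_mul, mul_assoc, hV.inv_mul_self, mul_one]
    _ ≤ _ := (norm_mApp_le _ _).trans (mul_le_mul_of_nonneg_right hl (norm_nonneg _))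

/-- Away from the stopping cubes, the square function of `f` is controlled by the average over
the top cube. -/
lemma tsum_sqTerm_not_stopped_le (hd : 0 < d) (hV : ∀ Q, (V Q).PosDef) (hκ : 1 ≤ κ) (hl : 1 ≤ l)
    {Q : DCube d} (hf : IntegrableOn f Q.set) (x : Fin d → ℝ) :
    ∑' I, {I : DCube d | x ∈ I.set ∧ I.set ⊆ Q.set ∧ I ∉ stopCubes κ l N V f Q ∧
        N ≤ I.k}.indicator (sqTerm V f) I ≤
      ENNReal.ofReal (l ^ 2) * (energyConst d κ *
        meanNorm (fun x => mApp (V Q) (f x)) Q ^ 2) := by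
  set g := fun x => mApp (V Q) (f x)
  have hnot : ∀ I : DCube d, I.set ⊆ Q.set → I ∉ stopCubes κ l N V f Q → N ≤ I.k →
      matNorm (V I * (V Q)⁻¹) ≤ l ∧
        towerEnergy g Q I ≤ energyConst d κ * meanNorm g Q ^ 2 := by
    intro I hIQ hI hIN
    by_cases hne : I = Q
    · subst hne
      refine ⟨?_, towerEnergy_self_le hd (integrableOn_mApp hf _) hκ⟩
      rw [(hV I).mul_inv_self]
      exact (matNorm_one_le).trans hl
    · simp only [stopCubes, Set.mem_ofPred_eq, not_and, not_or, not_lt, not_le] at hI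
      have := (hI hIQ hne hIN).2
      exact ⟨this.1.le, this.2⟩
  refine DCube.tsum_indicator_tower_le (fun I hI => hI.1) fun I hI => ?_
  obtain ⟨hxI, hIQ, hIB, hIN⟩ := hI
  refine le_trans ?_ (mul_le_mul' le_rfl (hnot I hIQ hIB hIN).2)
  rw [towerEnergy, ← ENNReal.tsum_mul_left]
  refine ENNReal.tsum_le_tsum fun K => ?_
  refine Set.indicator_apply_le' (fun hK => ?_) fun _ => zero_le
  obtain ⟨hIK, hxK, hKQ, hKB, hKN⟩ := hK
  rw [Set.indicator_of_mem (show K ∈ {K : DCube d | I.set ⊆ K.set ∧ K.set ⊆ Q.set} from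
    ⟨hIK, hKQ⟩)]
  exact sqTerm_le (hV Q) (hf.mono_set hKQ) (hnot K hKQ hKB hKN).1

lemma localSq_le_of_not_mem (hd : 0 < d) (hV : ∀ Q, (V Q).PosDef) (hκ : 1 ≤ κ) (hl : 1 ≤ l)
    {Q : DCube d} (hf : IntegrableOn f Q.set) {x : Fin d → ℝ}
    (hx : x ∉ ⋃ J ∈ stopCubes κ l N V f Q, J.set) :
    localSq V f N Q x ≤ ENNReal.ofReal (l ^ 2) * (energyConst d κ *
        meanNorm (fun x => mApp (V Q) (f x)) Q ^ 2) := by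
  refine le_trans (ENNReal.tsum_le_tsum fun I => ?_)
    (tsum_sqTerm_not_stopped_le (N := N) hd hV hκ hl hf x)
  refine Set.indicator_le_indicator_of_subset ?_ (fun _ => zero_le) I
  rintro I ⟨hxI, hIQ, hIN⟩
  exact ⟨hxI, hIQ, fun h => hx (Set.mem_biUnion h hxI), hIN⟩

lemma localSq_le_add (hd : 0 < d) (hV : ∀ Q, (V Q).PosDef) (hκ : 1 ≤ κ) (hl : 1 ≤ l)
    {Q R : DCube d} (hf : IntegrableOn f Q.set)
    (hR : R ∈ DCube.maximals (stopCubes κ l N V f Q)) {x : Fin d → ℝ} (hx : x ∈ R.set) :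
    localSq V f N Q x ≤ ENNReal.ofReal (l ^ 2) * (energyConst d κ *
        meanNorm (fun x => mApp (V Q) (f x)) Q ^ 2) + localSq V f N R x := by
  refine le_trans ?_
    (add_le_add (tsum_sqTerm_not_stopped_le (N := N) hd hV hκ hl hf x) le_rfl)
  rw [localSq, localSq, ← ENNReal.tsum_add]
  refine ENNReal.tsum_le_tsum fun I => ?_
  refine Set.indicator_apply_le' (fun hI => ?_) fun _ => zero_le
  obtain ⟨hxI, hIQ, hIN⟩ := hI
  by_cases hIR : I.set ⊆ R.set
  · refine le_trans ?_ le_add_self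
    rw [Set.indicator_of_mem]
    exact ⟨hxI, hIR, hIN⟩
  · refine le_trans ?_ le_self_add
    rw [Set.indicator_of_mem]
    refine ⟨hxI, hIQ, fun h => hIR ?_, hIN⟩
    obtain hk | hk := le_total I.k R.k
    · exact DCube.subset_of_mem hk hxI hx
    · exact (hR.2 I h (DCube.subset_of_mem hk hx hxI)).symm ▸ subset_rfl

end Stopping

/-! ## The estimate on a single cube -/

section Local

variable {d n : ℕ} {p c₁ c₂ l : ℝ} {κ : ℝ≥0∞} {N : ℤ}
  {W : (Fin d → ℝ) → Matrix (Fin n) (Fin n) ℂ} {V : DCube d → Matrix (Fin n) (Fin n) ℂ}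
  {f : (Fin d → ℝ) → EuclideanSpace ℂ (Fin n)}

lemma IsReducing.meanNorm_rpow_mul_volume_le (hV : IsReducing p c₁ c₂ W V) (hp : 1 < p)
    (hW : MatMeasurable W) (hpos : ∀ᵐ x ∂(volume : Measure (Fin d → ℝ)), (W x).PosDef)
    (hap : apNorm p W < ⊤) (Q : DCube d) {τ H : ℝ≥0∞}
    (h : ∫⁻ x in Q.set, invNorm W (V Q) x * ENNReal.ofReal ‖mApp (W x) (f x)‖ ≤
      τ ^ (1 / (p / (p - 1))) *
        (∫⁻ x in Q.set, invNorm W (V Q) x ^ (p / (p - 1))) ^ (1 / (p / (p - 1))) * H ^ (1 / p)) :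
    meanNorm (fun x => mApp (V Q) (f x)) Q ^ p * volume Q.set ≤
      τ ^ (p - 1) * (n * ENNReal.ofReal c₂) ^ p * apNorm p W * H := by
  have hp0 : 0 < p := by linarith
  have hp1 : 0 < p - 1 := by linarith
  have hv0 := Q.volume_set_ne_zero
  have hvt := Q.volume_set_ne_top
  set m := meanNorm (fun x => mApp (V Q) (f x)) Q
  set v := volume Q.set
  have e1 : 1 / (p / (p - 1)) * p = p - 1 := by field_simp
  have e2 : 1 / p * p = 1 := by field_simp
  have e3 : p / (p - 1) * (p - 1) = p := by field_simp
  have e4 : 1 / (p - 1) * (p - 1) = 1 := by field_simp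
  have h1 : m * v ≤ _ := (meanNorm_mul_volume _ Q).trans_le
    ((lintegral_enorm_mApp_le hpos (hV Q).1.isHermitian Q).trans h)
  have h2 := ENNReal.rpow_le_rpow h1 hp0.le
  rw [ENNReal.mul_rpow_of_nonneg _ _ hp0.le, ENNReal.mul_rpow_of_nonneg _ _ hp0.le,
    ENNReal.mul_rpow_of_nonneg _ _ hp0.le, ← ENNReal.rpow_mul, ← ENNReal.rpow_mul,
    ← ENNReal.rpow_mul, e1, e2, ENNReal.rpow_one] at h2
  have h3 := ENNReal.rpow_le_rpow (hV.lintegral_invNorm_rpow_le hp hW hpos hap Q) hp1.le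
  rw [ENNReal.mul_rpow_of_nonneg _ _ hp1.le, ENNReal.mul_rpow_of_nonneg _ _ hp1.le,
    ← ENNReal.rpow_mul, ← ENNReal.rpow_mul, e3, e4, ENNReal.rpow_one] at h3
  have hvp : v ^ p = v * v ^ (p - 1) := by
    conv_rhs => rw [← ENNReal.rpow_one v, ← ENNReal.rpow_mul, one_mul]
    rw [← ENNReal.rpow_add _ _ hv0 hvt, add_sub_cancel]
  refine (ENNReal.mul_le_mul_iff_left (c := v ^ (p - 1))
    (ENNReal.rpow_pos (pos_iff_ne_zero.2 hv0) hvt).ne'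
    (ENNReal.rpow_ne_top_of_nonneg hp1.le hvt)).1 ?_
  calc m ^ p * v * v ^ (p - 1) = m ^ p * v ^ p := by rw [hvp, mul_assoc]
    _ ≤ _ := h2
    _ ≤ τ ^ (p - 1) * ((n * ENNReal.ofReal c₂) ^ p * apNorm p W * v ^ (p - 1)) * H :=
        mul_le_mul' (mul_le_mul' le_rfl h3) le_rfl
    _ = _ := by ring

lemma lintegral_localSq_rpow_le (hd : 0 < d) (hn : 0 < n) (hp : 1 < p) (hc₁ : 0 < c₁)
    (hc₂ : 0 < c₂) (hW : MatMeasurable W)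
    (hpos : ∀ᵐ x ∂(volume : Measure (Fin d → ℝ)), (W x).PosDef)
    (hap : apNorm p W < ⊤) (hV : IsReducing p c₁ c₂ W V) (hf : StronglyMeasurable f)
    (hfp : ∫⁻ x, ENNReal.ofReal ‖mApp (W x) (f x)‖ ^ p ≠ ⊤) (hκ : κ = 3 * 2 ^ (p / 2 + 1))
    (hl : 1 ≤ l)
    (hlκ : κ * ((n : ℝ≥0∞) ^ p * ENNReal.ofReal c₂ ^ p * (ENNReal.ofReal c₁)⁻¹ ^ p) ≤
      ENNReal.ofReal l ^ p) {Q : DCube d} (hQ : N ≤ Q.k) :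
    ∫⁻ x in Q.set, localSq V f N Q x ^ (p / 2) ≤
      2 ^ (p / 2 + 1) * ((ENNReal.ofReal (l ^ 2) * energyConst d κ) ^ (p / 2) *
        ((ENNReal.ofReal (p / (p - 1)) * ainfConst p W) ^ (p - 1) *
          (n * ENNReal.ofReal c₂) ^ p * apNorm p W)) *
      (ENNReal.ofReal (p / (p - 1)) * ainfConst p W *
        ∫⁻ x in Q.set, ENNReal.ofReal ‖mApp (W x) (f x)‖ ^ p) := by
  have hp0 : 0 < p := by linarith
  have hp1 : 0 < p - 1 := by linarith
  have hpp : (p / (p - 1)).HolderConjugate p := (Real.HolderConjugate.conjExponent hp).symm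
  set p' := p / (p - 1) with hp'def
  have hp' : 1 < p' := hpp.lt
  have hfi : ∀ R : DCube d, IntegrableOn f R.set := fun R =>
    integrableOn_of_wNorm hp hW hpos hap hf hfp R
  have hVp : ∀ R, (V R).PosDef := fun R => (hV R).1
  have h2one : (1 : ℝ≥0∞) ≤ 2 ^ (p / 2 + 1) :=
    ENNReal.one_le_rpow (by norm_num) (by linarith)
  have h2le : (2 : ℝ≥0∞) ≤ 2 ^ (p / 2 + 1) := by
    conv_lhs => rw [← ENNReal.rpow_one 2]
    exact ENNReal.rpow_le_rpow_of_exponent_le (by norm_num) (by linarith)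
  have h2t : (2 : ℝ≥0∞) ^ (p / 2 + 1) ≠ ⊤ :=
    ENNReal.rpow_ne_top_of_nonneg (by linarith) (by norm_num)
  have hκ1 : 1 ≤ κ := by
    rw [hκ]; exact one_le_mul (by norm_num) h2one
  have hκt : κ ≠ ⊤ := by
    rw [hκ]; exact ENNReal.mul_ne_top (by norm_num) h2t
  set ch : DCube d → Set (DCube d) := fun R => DCube.maximals (stopCubes κ l N V f R) with hch
  have hchS : ∀ R, ch R ⊆ stopCubes κ l N V f R := fun R => DCube.maximals_subset _
  have hU : ∀ R, ⋃ J : ch R, (J : DCube d).set = ⋃ J ∈ stopCubes κ l N V f R, J.set := fun R =>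
    DCube.iUnion_maximals hd (N := R.k) fun J hJ => DCube.k_le_of_subset hd hJ.1
  have hvol : ∀ R, 2 ^ (p / 2 + 1) * volume (⋃ J : ch R, (J : DCube d).set) ≤ volume R.set := by
    intro R
    have h := volume_stopCubes_le (N := N) hd hn hp hc₁ hc₂ hW hV hκ1 hκt hlκ (hfi R)
    rw [hU]
    refine (ENNReal.mul_le_mul_iff_right (show (3 : ℝ≥0∞) ≠ 0 by norm_num)
      (show (3 : ℝ≥0∞) ≠ ⊤ by norm_num)).1 ?_
    rwa [← mul_assoc, ← hκ]
  set B := (ainfConst p W).toReal with hB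
  have hB1' := one_le_ainfConst hn hp hW hpos hap Q
  have hBt : ainfConst p W ≠ ⊤ := by
    rw [ainfConst]
    exact ENNReal.mul_ne_top (by norm_num) (ENNReal.rpow_ne_top_of_nonneg (by positivity)
      (ENNReal.mul_ne_top (by norm_num) hap.ne))
  have hBe : ENNReal.ofReal B = ainfConst p W := ENNReal.ofReal_toReal hBt
  have hB1 : 1 ≤ B := by
    rw [← hBe] at hB1'
    exact ENNReal.one_le_ofReal.1 hB1'
  have hT : 1 < p' * B := by nlinarith
  set η := 1 - 1 / (p' * B) with hη
  have hTi : 1 / (p' * B) < 1 := by rw [div_lt_one (by linarith)]; exact hT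
  have hTi0 : 0 < 1 / (p' * B) := by positivity
  have hτ : ENNReal.ofReal (1 / (1 - η)) = ENNReal.ofReal p' * ainfConst p W := by
    rw [hη, _root_.sub_sub_cancel, one_div_one_div, ENNReal.ofReal_mul (by linarith), hBe]
  have hbern : 1 - (ainfConst p W)⁻¹ ≤ ENNReal.ofReal (η ^ p') := by
    rw [← hBe, ← ENNReal.ofReal_inv_of_pos (by linarith), ← ENNReal.ofReal_one,
      ← ENNReal.ofReal_sub _ (by positivity)]
    refine ENNReal.ofReal_le_ofReal ?_
    have := one_add_mul_self_le_rpow_one_add (s := -(1 / (p' * B))) (by linarith) hp'.le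
    rw [← sub_eq_add_neg, ← hη] at this
    refine le_trans (le_of_eq ?_) this
    have : p' ≠ 0 := by linarith
    field_simp
    ring
  rw [← hτ]
  refine lintegral_rpow_le_of_stopping (N := N) (p := p) (p' := p') (q := p / 2) (η := η)
    (s := fun M => invNorm W M) (h := fun x => ENNReal.ofReal ‖mApp (W x) (f x)‖)
    (S := localSq V f N) (ch := ch)
    (a := fun R => ENNReal.ofReal (l ^ 2) * (energyConst d κ *
        meanNorm (fun x => mApp (V R) (f x)) R ^ 2))
    hpp (by linarith) (by linarith) (by linarith) (fun M => measurable_invNorm hW M)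
    (measurable_ofReal_norm_mApp hW hf) (fun R J hJ => (hchS R hJ).1)
    (fun R J hJ => ⟨(hchS R hJ).2.2.1, DCube.k_lt_of_subset hd (hchS R hJ).1 (hchS R hJ).2.1⟩)
    (fun R => DCube.pairwise_disjoint_maximals _) hvol ?_ ?_ ?_ ?_ Q hQ
  · intro M R
    refine (invNorm_rpow_lintegral_le_of_small hn hp hW hpos hap R M
      (MeasurableSet.iUnion fun J => J.1.measurableSet_set)
      (Set.iUnion_subset fun J => (hchS R J.2).1) ?_).trans (mul_le_mul' hbern le_rfl)
    exact (mul_le_mul' h2le le_rfl).trans (hvol R)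
  · intro R x hx
    refine localSq_le_of_not_mem hd hVp hκ1 hl (hfi R) ?_
    rw [← hU]
    exact hx.2
  · intro R J hJ x hx
    exact localSq_le_add hd hVp hκ1 hl (hfi R) hJ hx
  · intro R hR H hH
    have h := hV.meanNorm_rpow_mul_volume_le hp hW hpos hap R (hH (V R))
    rw [← mul_assoc, ENNReal.mul_rpow_of_nonneg _ _ (by linarith), ← ENNReal.rpow_natCast,
      ← ENNReal.rpow_mul, mul_assoc, mul_assoc]
    refine mul_le_mul' le_rfl ?_
    have e : ((2 : ℕ) : ℝ) * (p / 2) = p := by push_cast; ring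
    rw [e]
    exact h

end Local

/-! ## From single cubes to the whole space -/

section Global

variable {d n : ℕ} {V : DCube d → Matrix (Fin n) (Fin n) ℂ}
  {f : (Fin d → ℝ) → EuclideanSpace ℂ (Fin n)}

/-- The part of the square function coming from the cubes of scale between `-N` and `N`. -/
def truncSq (V : DCube d → Matrix (Fin n) (Fin n) ℂ)
    (f : (Fin d → ℝ) → EuclideanSpace ℂ (Fin n)) (N : ℕ) (x : Fin d → ℝ) : ℝ≥0∞ :=
  ∑' I, {I : DCube d | x ∈ I.set ∧ |I.k| ≤ N}.indicator (sqTerm V f) I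

lemma truncSq_eq_localSq (hd : 0 < d) {N : ℕ} {Q : DCube d} (hQ : Q.k = N) {x : Fin d → ℝ}
    (hx : x ∈ Q.set) : truncSq V f N x = localSq V f (-N) Q x := by
  unfold truncSq localSq
  congr! 3 with I
  ext I
  simp only [Set.mem_ofPred_eq, abs_le]
  constructor
  · rintro ⟨hI, h1, h2⟩
    exact ⟨hI, DCube.subset_of_mem (by omega) hI hx, h1⟩
  · rintro ⟨hI, h1, h2⟩
    exact ⟨hI, h2, (DCube.k_le_of_subset hd h1).trans hQ.le⟩

lemma measurable_truncSq (N : ℕ) : Measurable (truncSq V f N) := by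
  have : truncSq V f N = fun x => ∑' I : DCube d, I.set.indicator
      (fun _ => {I : DCube d | |I.k| ≤ N}.indicator (sqTerm V f) I) x := by
    funext x
    unfold truncSq
    congr 1
    funext I
    by_cases h1 : x ∈ I.set <;> by_cases h2 : |I.k| ≤ N <;> simp [Set.indicator, h1, h2]
  rw [this]
  exact Measurable.tsum fun I => measurable_const.indicator I.measurableSet_set

lemma truncSq_mono : Monotone (truncSq V f) := by
  intro N M hNM x
  refine ENNReal.tsum_le_tsum fun I => ?_
  refine Set.indicator_le_indicator_of_subset ?_ (fun _ => zero_le) I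
  rintro I ⟨h1, h2⟩
  exact ⟨h1, h2.trans (by exact_mod_cast hNM)⟩

lemma sqFn_eq_tsum (hf : ∀ I : DCube d, IntegrableOn f I.set) (x : Fin d → ℝ) :
    sqFn V f x = ∑' I, {I : DCube d | x ∈ I.set}.indicator (sqTerm V f) I := by
  unfold sqFn
  congr 1
  funext I
  by_cases h : x ∈ I.set
  · rw [Set.indicator_of_mem (show I ∈ {I : DCube d | x ∈ I.set} from h), sqTerm, haarEnergy,
      I.volume_set, div_eq_mul_inv, Finset.sum_mul]
    refine Finset.sum_congr rfl fun ε _ => ?_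
    rw [Set.indicator_of_mem h, haarCoef_mApp (hf I), div_eq_mul_inv]
  · rw [Set.indicator_of_notMem (show I ∉ {I : DCube d | x ∈ I.set} from h)]
    exact Finset.sum_eq_zero fun ε _ => Set.indicator_of_notMem h _

lemma iSup_truncSq (hf : ∀ I : DCube d, IntegrableOn f I.set) (x : Fin d → ℝ) :
    sqFn V f x = ⨆ N, truncSq V f N x := by
  rw [sqFn_eq_tsum hf]
  refine le_antisymm ?_ (iSup_le fun N => ENNReal.tsum_le_tsum fun I =>
    Set.indicator_le_indicator_of_subset (fun I h => h.1) (fun _ => zero_le) I)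
  rw [ENNReal.tsum_eq_iSup_sum]
  refine iSup_le fun T => ?_
  refine le_trans ?_ (le_iSup _ (T.sup fun I => I.k.natAbs))
  refine le_trans (Finset.sum_le_sum fun I hI => ?_) (ENNReal.sum_le_tsum T)
  refine Set.indicator_apply_le' (fun h => ?_) fun _ => zero_le
  rw [Set.indicator_of_mem]
  refine ⟨h, ?_⟩
  have := Finset.le_sup (f := fun I : DCube d => I.k.natAbs) hI
  rw [Int.abs_eq_natAbs]
  exact_mod_cast this

lemma lintegral_eq_tsum_scale (k : ℤ) (u : (Fin d → ℝ) → ℝ≥0∞) :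
    ∫⁻ x, u x = ∑' Q : {Q : DCube d // Q.k = k}, ∫⁻ x in (Q : DCube d).set, u x := by
  rw [← lintegral_iUnion (fun Q => Q.1.measurableSet_set), ← setLIntegral_univ]
  · congr 2
    refine (Set.eq_univ_of_forall fun x => ?_).symm
    exact Set.mem_iUnion.2 ⟨⟨DCube.containing k x, rfl⟩, DCube.mem_containing _ _⟩
  · intro Q R hQR
    refine Set.disjoint_left.2 fun x hx hx' => hQR (Subtype.ext ?_)
    exact DCube.eq_of_mem (Q.2.trans R.2.symm) hx hx'

lemma lintegral_sqFn_rpow_le (hd : 0 < d) {q : ℝ} (hq : 0 < q)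
    (hf : ∀ I : DCube d, IntegrableOn f I.set) {u : (Fin d → ℝ) → ℝ≥0∞} {C : ℝ≥0∞}
    (h : ∀ (N : ℤ) (Q : DCube d), N ≤ Q.k →
      ∫⁻ x in Q.set, localSq V f N Q x ^ q ≤ C * ∫⁻ x in Q.set, u x) :
    ∫⁻ x, sqFn V f x ^ q ≤ C * ∫⁻ x, u x := by
  have hS : ∀ x, sqFn V f x ^ q = ⨆ N, truncSq V f N x ^ q := fun x => by
    rw [iSup_truncSq hf]
    exact (ENNReal.monotone_rpow_of_nonneg hq.le).map_iSup_of_continuousAt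
      ENNReal.continuous_rpow_const.continuousAt (by simp [hq])
  simp only [hS]
  rw [lintegral_iSup (fun N => (measurable_truncSq N).pow_const q)
    fun N M hNM x => ENNReal.rpow_le_rpow (truncSq_mono hNM x) hq.le]
  refine iSup_le fun N => ?_
  rw [lintegral_eq_tsum_scale (N : ℤ) u, lintegral_eq_tsum_scale (N : ℤ), ← ENNReal.tsum_mul_left]
  refine ENNReal.tsum_le_tsum fun Q => ?_
  rw [setLIntegral_congr_fun Q.1.measurableSet_set
    fun x hx => by rw [truncSq_eq_localSq hd Q.2 hx]]
  exact h _ _ (by have := Q.2; omega)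

end Global

lemma apNorm_rpow_le {d n : ℕ} {p : ℝ} {W : (Fin d → ℝ) → Matrix (Fin n) (Fin n) ℂ}
    (hn : 0 < n) (hp : 1 < p) (hW : MatMeasurable W)
    (hpos : ∀ᵐ x ∂(volume : Measure (Fin d → ℝ)), (W x).PosDef) (hap : apNorm p W < ⊤)
    {a b : ℝ} (hab : a ≤ b) :
    apNorm p W ^ a ≤ (4 ^ p) ^ (b - a) * apNorm p W ^ b := by
  have hp1 : 0 < p - 1 := by linarith
  have h0 := apNorm_ne_zero hn hp hW hpos ⟨0, 0⟩
  have h1 : 1 ≤ 4 ^ p * apNorm p W := by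
    have h := ENNReal.rpow_le_rpow (one_le_ainfConst hn hp hW hpos hap ⟨0, 0⟩) hp1.le
    rw [ENNReal.one_rpow, ainfConst, ENNReal.mul_rpow_of_nonneg _ _ hp1.le, ← ENNReal.rpow_mul,
      one_div_mul_cancel hp1.ne', ENNReal.rpow_one, ← mul_assoc] at h
    convert h using 2
    conv_rhs => rhs; rw [← ENNReal.rpow_one 4]
    rw [← ENNReal.rpow_add _ _ (by norm_num) (by norm_num)]
    congr 1
    ring
  calc apNorm p W ^ a = 1 * apNorm p W ^ a := (one_mul _).symm
    _ ≤ (4 ^ p * apNorm p W) ^ (b - a) * apNorm p W ^ a :=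
        mul_le_mul' (by simpa using ENNReal.rpow_le_rpow h1 (sub_nonneg.2 hab)) le_rfl
    _ = _ := by
        rw [ENNReal.mul_rpow_of_nonneg _ _ (sub_nonneg.2 hab), mul_assoc,
          ← ENNReal.rpow_add _ _ h0 hap.ne, sub_add_cancel]

/-- If `1 < p < ∞` and `W` is a matrix `A_p` weight on `ℝ^d` with reducing
operators `V_I`, then there is a constant `C = C(p, n, d)` (and depending on the fixed
comparability constants `c₁, c₂` of the reducing operators) such that for every
`f ∈ L^p(W)`:
`(∫_{ℝ^d} (∑_{I ∈ 𝒟} ∑_{ε ∈ 𝒮} |V_I f_I^ε|² |I|^{-1} χ_I(x))^{p/2} dx)^{1/p}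
   ≤ C ‖W‖_{A_p}^{2/p + ⌈p'⌉/p} ‖f‖_{L^p(W)}`, where `p' = p/(p-1)`. -/
theorem statement1 (d n : ℕ) (hd : 0 < d) (hn : 0 < n) (p c₁ c₂ : ℝ)
    (hp : 1 < p) (hc₁ : 0 < c₁) (hc₂ : 0 < c₂) :
    ∃ C : ℝ≥0∞, 0 < C ∧ C < ⊤ ∧
      ∀ (W1p : (Fin d → ℝ) → Matrix (Fin n) (Fin n) ℂ)
        (V : DCube d → Matrix (Fin n) (Fin n) ℂ)
        (f : (Fin d → ℝ) → EuclideanSpace ℂ (Fin n)),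
        MatMeasurable W1p →
        (∀ᵐ x ∂(volume : Measure (Fin d → ℝ)), (W1p x).PosDef) →
        apNorm p W1p < ⊤ →
        IsReducing p c₁ c₂ W1p V →
        StronglyMeasurable f →
        wNorm p W1p f < ⊤ →
        (∫⁻ x, sqFn V f x ^ (p / 2)) ^ (1 / p) ≤
          C * apNorm p W1p ^ ((2 + (⌈p / (p - 1)⌉₊ : ℝ)) / p) * wNorm p W1p f := by
  have hp0 : 0 < p := by linarith
  have hp1 : 0 < p - 1 := by linarith
  have hpinv : 0 ≤ 1 / p := by positivity
  set p' := p / (p - 1) with hp'def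
  have hp' : 0 < p' := div_pos hp0 hp1
  set κ : ℝ≥0∞ := 3 * 2 ^ (p / 2 + 1) with hκ
  have h2t : (2 : ℝ≥0∞) ^ (p / 2 + 1) ≠ ⊤ :=
    ENNReal.rpow_ne_top_of_nonneg (by linarith) (by norm_num)
  have hκt : κ ≠ ⊤ := ENNReal.mul_ne_top (by norm_num) h2t
  obtain ⟨l, hl, hlκ⟩ : ∃ l : ℝ, 1 ≤ l ∧
      κ * ((n : ℝ≥0∞) ^ p * ENNReal.ofReal c₂ ^ p * (ENNReal.ofReal c₁)⁻¹ ^ p) ≤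
        ENNReal.ofReal l ^ p := by
    set Y := κ * ((n : ℝ≥0∞) ^ p * ENNReal.ofReal c₂ ^ p * (ENNReal.ofReal c₁)⁻¹ ^ p)
    have hY : Y ^ (1 / p) ≠ ⊤ := by
      refine ENNReal.rpow_ne_top_of_nonneg hpinv (ENNReal.mul_ne_top hκt
        (ENNReal.mul_ne_top (ENNReal.mul_ne_top
          (ENNReal.rpow_ne_top_of_nonneg hp0.le (ENNReal.natCast_ne_top n))
          (ENNReal.rpow_ne_top_of_nonneg hp0.le ENNReal.ofReal_ne_top))
          (ENNReal.rpow_ne_top_of_nonneg hp0.le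
            (ENNReal.inv_ne_top.2 (by simpa using hc₁)))))
    refine ⟨(Y ^ (1 / p)).toReal + 1, by simp, ?_⟩
    calc Y = (Y ^ (1 / p)) ^ p := by
          rw [← ENNReal.rpow_mul, one_div_mul_cancel hp0.ne', ENNReal.rpow_one]
      _ ≤ _ := by
          refine ENNReal.rpow_le_rpow ?_ hp0.le
          rw [← ENNReal.ofReal_toReal hY]
          exact ENNReal.ofReal_le_ofReal (by simp)
  set K := ENNReal.ofReal (l ^ 2) * energyConst d κ with hK
  have hKt : K ≠ ⊤ := by
    rw [hK, energyConst]
    exact ENNReal.mul_ne_top ENNReal.ofReal_ne_top (ENNReal.mul_ne_top (ENNReal.mul_ne_top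
      (by finiteness) (by finiteness)) (ENNReal.pow_ne_top hκt))
  set e : ℝ := 2 + (⌈p'⌉₊ : ℝ) with he
  have hae : 1 + p' ≤ e := by linarith [Nat.le_ceil p']
  set C₀ : ℝ≥0∞ := 2 ^ (p / 2 + 1) * K ^ (p / 2) * (n * ENNReal.ofReal c₂) ^ p *
    (ENNReal.ofReal p' * 4) ^ p * 4 ^ p' * (4 ^ p) ^ (e - (1 + p')) with hC₀
  have hC₀t : C₀ ≠ ⊤ := by
    refine ENNReal.mul_ne_top (ENNReal.mul_ne_top (ENNReal.mul_ne_top (ENNReal.mul_ne_top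
      (ENNReal.mul_ne_top h2t ?_) ?_) ?_) ?_) ?_
    · exact ENNReal.rpow_ne_top_of_nonneg (by linarith) hKt
    · exact ENNReal.rpow_ne_top_of_nonneg hp0.le
        (ENNReal.mul_ne_top (ENNReal.natCast_ne_top n) ENNReal.ofReal_ne_top)
    · exact ENNReal.rpow_ne_top_of_nonneg hp0.le
        (ENNReal.mul_ne_top ENNReal.ofReal_ne_top (by norm_num))
    · exact ENNReal.rpow_ne_top_of_nonneg hp'.le (by norm_num)
    · exact ENNReal.rpow_ne_top_of_nonneg (sub_nonneg.2 hae)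
        (ENNReal.rpow_ne_top_of_nonneg hp0.le (by norm_num))
  refine ⟨C₀ ^ (1 / p) + 1, by simp, ENNReal.add_lt_top.2
    ⟨(ENNReal.rpow_ne_top_of_nonneg hpinv hC₀t).lt_top, ENNReal.one_lt_top⟩, ?_⟩
  intro W V f hW hpos hap hV hf hfw
  have hfp : ∫⁻ x, ENNReal.ofReal ‖mApp (W x) (f x)‖ ^ p ≠ ⊤ := by
    intro h
    rw [wNorm, h, ENNReal.top_rpow_of_pos (by positivity)] at hfw
    exact lt_irrefl _ hfw
  have hA0 := apNorm_ne_zero hn hp hW hpos ⟨0, 0⟩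
  set A := apNorm p W with hA
  set τ := ENNReal.ofReal p' * ainfConst p W with hτ
  have hτ0 : τ ≠ 0 := by
    refine mul_ne_zero (by simpa using hp') ?_
    exact (zero_lt_one.trans_le (one_le_ainfConst hn hp hW hpos hap ⟨0, 0⟩)).ne'
  have hτp : τ ^ p = (ENNReal.ofReal p' * 4) ^ p * 4 ^ p' * A ^ p' := by
    rw [hτ, ainfConst, ← mul_assoc, ENNReal.mul_rpow_of_nonneg _ _ hp0.le, ← ENNReal.rpow_mul,
      mul_assoc, ← ENNReal.mul_rpow_of_nonneg _ _ hp'.le]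
    congr 2
    rw [hp'def]
    ring
  have hτt : τ ≠ ⊤ := by
    intro h
    rw [h, ENNReal.top_rpow_of_pos hp0] at hτp
    refine absurd hτp.symm (ENNReal.mul_ne_top (ENNReal.mul_ne_top ?_ ?_) ?_)
    · exact ENNReal.rpow_ne_top_of_nonneg hp0.le
        (ENNReal.mul_ne_top ENNReal.ofReal_ne_top (by norm_num))
    · exact ENNReal.rpow_ne_top_of_nonneg hp'.le (by norm_num)
    · exact ENNReal.rpow_ne_top_of_nonneg hp'.le hap.ne
  have hτ1 : τ ^ (p - 1) * τ = τ ^ p := by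
    conv_lhs => rhs; rw [← ENNReal.rpow_one τ]
    rw [← ENNReal.rpow_add _ _ hτ0 hτt, sub_add_cancel]
  have hA1 : A * A ^ p' = A ^ (1 + p') := by
    rw [ENNReal.rpow_add _ _ hA0 hap.ne, ENNReal.rpow_one]
  have hmain : ∫⁻ x, sqFn V f x ^ (p / 2) ≤
      C₀ * A ^ e * ∫⁻ x, ENNReal.ofReal ‖mApp (W x) (f x)‖ ^ p := by
    refine lintegral_sqFn_rpow_le hd (by linarith)
      (integrableOn_of_wNorm hp hW hpos hap hf hfp) fun N Q hQ => ?_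
    refine (lintegral_localSq_rpow_le hd hn hp hc₁ hc₂ hW hpos hap hV hf hfp hκ hl hlκ
      hQ).trans ?_
    rw [← hK, ← mul_assoc]
    refine mul_le_mul' ?_ le_rfl
    calc _ = 2 ^ (p / 2 + 1) * K ^ (p / 2) * (n * ENNReal.ofReal c₂) ^ p * A *
          (τ ^ (p - 1) * τ) := by ring
      _ = 2 ^ (p / 2 + 1) * K ^ (p / 2) * (n * ENNReal.ofReal c₂) ^ p *
          (ENNReal.ofReal p' * 4) ^ p * 4 ^ p' * A ^ (1 + p') := by
          rw [hτ1, hτp, ← hA1]; ring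
      _ ≤ _ := by
          rw [hC₀, mul_assoc _ ((4 ^ p : ℝ≥0∞) ^ _)]
          exact mul_le_mul' le_rfl (apNorm_rpow_le hn hp hW hpos hap hae)
  calc _ ≤ (C₀ * A ^ e * ∫⁻ x, ENNReal.ofReal ‖mApp (W x) (f x)‖ ^ p) ^ (1 / p) :=
        ENNReal.rpow_le_rpow hmain hpinv
    _ = C₀ ^ (1 / p) * A ^ (e / p) * wNorm p W f := by
        rw [ENNReal.mul_rpow_of_nonneg _ _ hpinv, ENNReal.mul_rpow_of_nonneg _ _ hpinv,
          ← ENNReal.rpow_mul, mul_one_div, wNorm]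
    _ ≤ _ := mul_le_mul' (mul_le_mul' le_self_add le_rfl) le_rfl

end
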